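/- arXiv:1106.3546 — 3 statements merged into one kernel-verified Lean document; each statement's English description precedes it below -/
import Mathlib

section
/- For δ ∈ (0,1/3] and r = δ/(2-δ), the logarithmic capacity of the cluster K₀ ∪ P₁, where P₁ = {z ∈ D₀ : |z-1| ≤ r|z+1|} is attached to the closed unit disc K₀, equals log((1+r²)/(1-r²)) and satisfies log((1+r²)/(1-r²)) ≤ 3δ²/4. -/
/-- `F` is the normalized conformal map from the exterior `D₀` of the closed unit disc
onto the complement of `K`, with `F(z) = e^c z + O(1)` at infinity.  The constant `c`
is then the logarithmic capacity `cap K`. -/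
def IsNormalizedExteriorMap (K : Set ℂ) (c : ℝ) (F : ℂ → ℂ) : Prop :=
  DifferentiableOn ℂ F {z : ℂ | 1 < ‖z‖} ∧
  Set.BijOn F {z : ℂ | 1 < ‖z‖} Kᶜ ∧
  ∃ M : ℝ, ∀ z : ℂ, 1 < ‖z‖ → ‖F z - Real.exp c * z‖ ≤ M

open Set Metric Topology Complex in
/-- A holomorphic bijection of the unit disc is proper. -/
theorem exists_lt_norm_of_bijOn_ball {f : ℂ → ℂ} (hf : DifferentiableOn ℂ f (ball 0 1))
    (hb : BijOn f (ball 0 1) (ball 0 1)) {s : ℝ} (hs : s < 1) :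
    ∃ ρ < 1, ∀ u ∈ ball (0 : ℂ) 1, ρ < ‖u‖ → s < ‖f u‖ := by
  have hopen : ∀ t ⊆ ball (0 : ℂ) 1, IsOpen t → IsOpen (f '' t) := by
    refine ((hf.analyticOnNhd isOpen_ball).is_constant_or_isOpen
      (convex_ball _ _).isPreconnected).resolve_left ?_
    rintro ⟨w, hw⟩
    have h0 : (0 : ℂ) ∈ ball (0 : ℂ) 1 := by simp
    have h1 : (1 / 2 : ℂ) ∈ ball (0 : ℂ) 1 := by norm_num
    have := hb.injOn h0 h1 ((hw _ h0).trans (hw _ h1).symm)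
    norm_num at this
  set g := Function.invFunOn f (ball 0 1)
  have hleft : LeftInvOn g f (ball 0 1) := hb.injOn.leftInvOn_invFunOn
  have hcont : ContinuousOn g (ball 0 1) := by
    have h := IsOpenMap.continuousOn_image_of_leftInvOn (f := f) (s := ball 0 1) (finv := g) ?_
      hleft
    · rwa [hb.image_eq] at h
    · intro t ht
      have h2 := hopen (Subtype.val '' t) (by rintro _ ⟨x, -, rfl⟩; exact x.2)
        (isOpen_ball.isOpenMap_subtype_val t ht)
      rwa [image_image] at h2
  rcases lt_or_ge s 0 with hs0 | hs0
  · exact ⟨0, one_pos, fun u _ _ => hs0.trans_le (norm_nonneg _)⟩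
  have hsub : closedBall (0 : ℂ) s ⊆ ball 0 1 := closedBall_subset_ball hs
  obtain ⟨w, hw, hmax⟩ := (isCompact_closedBall (0 : ℂ) s).exists_isMaxOn
    ⟨0, by simpa using hs0⟩ (hcont.mono hsub).norm
  refine ⟨‖g w‖, ?_, fun u hu hlt => ?_⟩
  · have := (hb.surjOn.mapsTo_invFunOn) (hsub hw)
    simpa using this
  · by_contra! hle
    have h3 : ‖g (f u)‖ ≤ ‖g w‖ := hmax (by simpa using hle)
    rw [hleft hu] at h3
    linarith

open Set Metric Topology Complex in
/-- Maximum principle for a function whose norm has boundary limit superior at most one. -/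
theorem norm_zero_le_one_of_boundary {q : ℂ → ℂ} (hq : DifferentiableOn ℂ q (ball 0 1))
    (h : ∀ s : ℝ, 0 < s → s < 1 → ∃ ρ < 1, ∀ u ∈ ball (0 : ℂ) 1, ρ < ‖u‖ → ‖q u‖ ≤ s⁻¹) :
    ‖q 0‖ ≤ 1 := by
  have key : ∀ s : ℝ, 0 < s → s < 1 → s * ‖q 0‖ ≤ 1 := by
    intro s h0 h1
    obtain ⟨ρ, hρ, hb⟩ := h s h0 h1
    obtain ⟨t, ht, ht1⟩ := exists_between (max_lt hρ one_pos)
    have ht0 : 0 < t := (le_max_right _ _).trans_lt ht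
    have := norm_le_of_forall_mem_frontier_norm_le (f := q) (U := ball 0 t) isBounded_ball
      (DifferentiableOn.diffContOnCl (hq.mono (by
        rw [closure_ball _ ht0.ne']; exact closedBall_subset_ball ht1))) (C := s⁻¹)
      (fun z hz => by
        rw [frontier_ball _ ht0.ne', mem_sphere_zero_iff_norm] at hz
        exact hb z (by simpa [hz] using ht1) (by rw [hz]; exact (le_max_left _ _).trans_lt ht))
      (z := 0) (subset_closure (mem_ball_self ht0))
    calc s * ‖q 0‖ ≤ s * s⁻¹ := by gcongr
      _ = 1 := mul_inv_cancel₀ h0.ne'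
  by_contra! hgt
  obtain ⟨s, hs, hs1⟩ := exists_between (inv_lt_one_of_one_lt₀ hgt)
  have hpos : 0 < ‖q 0‖ := one_pos.trans hgt
  have h1 := key s ((inv_pos.2 hpos).trans hs) hs1
  have h2 : 1 < s * ‖q 0‖ := by
    calc 1 = ‖q 0‖⁻¹ * ‖q 0‖ := (inv_mul_cancel₀ hpos.ne').symm
      _ < s * ‖q 0‖ := by gcongr
  linarith

open Set Metric Topology Complex in
theorem norm_zero_eq_one_of_bijOn_ball {q : ℂ → ℂ} (hq : DifferentiableOn ℂ q (ball 0 1))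
    (hq0 : ∀ u ∈ ball (0 : ℂ) 1, q u ≠ 0)
    (hb : BijOn (fun u => u * q u) (ball 0 1) (ball 0 1)) : ‖q 0‖ = 1 := by
  apply le_antisymm
  · refine norm_zero_le_one_of_boundary hq fun s h0 h1 => ⟨s, h1, fun u hu hsu => ?_⟩
    have h2 : ‖u‖ * ‖q u‖ < 1 := by simpa using hb.mapsTo hu
    rw [le_inv_comm₀ (norm_pos_iff.2 (hq0 u hu)) h0]
    refine hsu.le.trans ?_
    rw [← one_div, le_div_iff₀ (norm_pos_iff.2 (hq0 u hu))]
    exact h2.le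
  · have h := norm_zero_le_one_of_boundary (q := fun u => (q u)⁻¹) (hq.inv hq0) ?_
    · rw [norm_inv] at h
      exact (inv_le_one₀ (norm_pos_iff.2 (hq0 0 (by simp)))).1 h
    intro s h0 h1
    obtain ⟨ρ, hρ, hlt⟩ := exists_lt_norm_of_bijOn_ball (differentiableOn_id.mul hq) hb h1
    refine ⟨ρ, hρ, fun u hu hu' => ?_⟩
    have h2 : s < ‖u‖ * ‖q u‖ := by simpa using hlt u hu hu'
    have h3 : ‖u‖ < 1 := by simpa using hu
    have hpos := norm_pos_iff.2 (hq0 u hu)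
    rw [norm_inv, inv_le_inv₀ hpos h0]
    nlinarith

theorem normSq_cluster_map_sub (a : ℝ) (z : ℂ) :
    Complex.normSq (z * (a * z - 1)) - Complex.normSq (z - a) =
      a * (Complex.normSq z - 1) * (a * (Complex.normSq z + 1) - 2 * z.re) := by
  simp only [Complex.normSq_apply, Complex.mul_re, Complex.mul_im, Complex.sub_re,
    Complex.sub_im, Complex.ofReal_re, Complex.ofReal_im, Complex.one_re, Complex.one_im]
  ring

theorem one_lt_norm_iff_normSq (z : ℂ) : 1 < ‖z‖ ↔ 1 < Complex.normSq z := by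
  rw [← Complex.sq_norm, one_lt_sq_iff₀ (norm_nonneg z)]

theorem compl_closedBall_union_iff {r : ℝ} (hr : 0 ≤ r) (z : ℂ) :
    z ∈ (Metric.closedBall (0 : ℂ) 1 ∪ {z : ℂ | 1 < ‖z‖ ∧ ‖z - 1‖ ≤ r * ‖z + 1‖})ᶜ ↔
      1 < ‖z‖ ∧ 2 * z.re < (1 - r ^ 2) / (1 + r ^ 2) * (Complex.normSq z + 1) := by
  have hpos : 0 < 1 + r ^ 2 := by positivity
  have h1 : r * ‖z + 1‖ < ‖z - 1‖ ↔
      2 * z.re < (1 - r ^ 2) / (1 + r ^ 2) * (Complex.normSq z + 1) := by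
    rw [← sq_lt_sq₀ (by positivity) (norm_nonneg _), mul_pow, Complex.sq_norm, Complex.sq_norm,
      div_mul_eq_mul_div, lt_div_iff₀ hpos]
    simp only [Complex.normSq_apply, Complex.add_re, Complex.add_im, Complex.sub_re,
      Complex.sub_im, Complex.one_re, Complex.one_im]
    constructor <;> intro h <;> nlinarith
  rw [← h1]
  simp only [Set.mem_compl_iff, Set.mem_union, mem_closedBall_zero_iff, Set.mem_ofPred_eq, not_or,
    not_le, not_and]
  exact ⟨fun h => ⟨h.1, h.2 h.1⟩, fun h => ⟨h.1, fun _ => h.2⟩⟩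

/-- The explicit conformal map of the complement of the cluster onto the exterior disc. -/
theorem bijOn_cluster_map {a : ℝ} (ha : 0 < a) (ha1 : a < 1) :
    Set.BijOn (fun z : ℂ => z * (a * z - 1) / (z - a))
      {z : ℂ | 1 < ‖z‖ ∧ 2 * z.re < a * (Complex.normSq z + 1)} {z : ℂ | 1 < ‖z‖} := by
  have hne : ∀ z : ℂ, 1 < ‖z‖ → z - a ≠ 0 := by
    intro z hz h
    rw [sub_eq_zero.1 h, Complex.norm_real, Real.norm_of_nonneg ha.le] at hz
    linarith
  have hiff : ∀ z : ℂ, z - a ≠ 0 → (1 < ‖z * (a * z - 1) / (z - a)‖ ↔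
      0 < (Complex.normSq z - 1) * (a * (Complex.normSq z + 1) - 2 * z.re)) := by
    intro z hz
    rw [one_lt_norm_iff_normSq, Complex.normSq_div, one_lt_div (Complex.normSq_pos.2 hz),
      ← sub_pos, normSq_cluster_map_sub, mul_assoc, mul_pos_iff_of_pos_left ha]
  have hsmall : ∀ z : ℂ, 1 < ‖z‖ → ‖(a * z - 1) / (z - a)‖ < 1 := by
    intro z hz
    rw [norm_div, div_lt_one (norm_pos_iff.2 (hne z hz)),
      ← sq_lt_sq₀ (norm_nonneg _) (norm_nonneg _), Complex.sq_norm, Complex.sq_norm]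
    rw [one_lt_norm_iff_normSq] at hz
    simp only [Complex.normSq_apply, Complex.mul_re, Complex.mul_im, Complex.sub_re,
      Complex.sub_im, Complex.ofReal_re, Complex.ofReal_im, Complex.one_re,
      Complex.one_im] at hz ⊢
    nlinarith [mul_pos (sub_pos.2 hz) (show 0 < 1 - a ^ 2 by nlinarith)]
  have ha0 : (a : ℂ) ≠ 0 := by exact_mod_cast ha.ne'
  refine ⟨?_, ?_, ?_⟩
  · rintro z ⟨h1, h2⟩
    refine (hiff z (hne z h1)).2 (mul_pos ?_ (by linarith))
    rw [one_lt_norm_iff_normSq] at h1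
    linarith
  · rintro z ⟨hz, -⟩ w ⟨hw, -⟩ h
    by_contra hzw
    have h1 := hne z hz
    have h2 := hne w hw
    have h3 : w = (a * z - 1) / (z - a) := by
      simp only at h
      rw [div_eq_div_iff h1 h2] at h
      rw [eq_div_iff h1]
      have h4 : (z - w) * (a * (w * (z - a) - (a * z - 1))) = 0 := by linear_combination h
      exact sub_eq_zero.1 (((mul_eq_zero.1 h4).resolve_left (sub_ne_zero.2 hzw) |>
        mul_eq_zero.1).resolve_left ha0)
    have := hsmall z hz
    rw [← h3] at this
    linarith
  · intro ζ hζ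
    obtain ⟨s, hs⟩ := IsAlgClosed.exists_pow_nat_eq (discrim (a : ℂ) (-(1 + ζ)) (a * ζ)) two_pos
    obtain ⟨z₀, hz₀⟩ := exists_quadratic_eq_zero ha0 ⟨s, by rw [← sq, hs]⟩
    have hζ1 : 1 < ‖ζ‖ := hζ
    obtain ⟨z, hz, hz1⟩ : ∃ z : ℂ, a * (z * z) + -(1 + ζ) * z + a * ζ = 0 ∧ 1 < ‖z‖ := by
      by_cases h : 1 < ‖z₀‖
      · exact ⟨z₀, hz₀, h⟩
      refine ⟨(1 + ζ) / a - z₀, ?_, ?_⟩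
      · field_simp
        linear_combination (a : ℂ) * hz₀
      · have hprod : z₀ * ((1 + ζ) / a - z₀) = ζ := by
          field_simp
          linear_combination -hz₀
        by_contra! h'
        have h3 : ‖z₀‖ * ‖(1 + ζ) / a - z₀‖ ≤ 1 := mul_le_one₀ (not_lt.1 h) (norm_nonneg _) h'
        rw [← norm_mul, hprod] at h3
        linarith
    have hζz : z * (a * z - 1) / (z - a) = ζ := by
      rw [div_eq_iff (hne z hz1)]
      linear_combination hz
    refine ⟨z, ⟨hz1, ?_⟩, hζz⟩
    have h3 := (hiff z (hne z hz1)).1 (by rwa [hζz])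
    rw [one_lt_norm_iff_normSq] at hz1
    linarith [(mul_pos_iff_of_pos_left (sub_pos.2 hz1)).1 h3]

open Set Metric Topology Complex in
theorem bijOn_ball_of_bijOn_exterior {H f : ℂ → ℂ}
    (hH : BijOn H {z : ℂ | 1 < ‖z‖} {z : ℂ | 1 < ‖z‖}) (h0 : f 0 = 0)
    (hf : ∀ u ∈ ball (0 : ℂ) 1, u ≠ 0 → f u = (H u⁻¹)⁻¹) :
    BijOn f (ball 0 1) (ball 0 1) := by
  have hinv : ∀ u ∈ ball (0 : ℂ) 1, u ≠ 0 → u⁻¹ ∈ {z : ℂ | 1 < ‖z‖} := by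
    intro u hu hu0
    rw [mem_ofPred_eq, norm_inv]
    exact (one_lt_inv₀ (norm_pos_iff.2 hu0)).2 (by simpa using hu)
  have hne : ∀ z ∈ {z : ℂ | 1 < ‖z‖}, z ≠ 0 := by
    rintro z hz rfl
    norm_num at hz
  have hball : ∀ z ∈ {z : ℂ | 1 < ‖z‖}, z⁻¹ ∈ ball (0 : ℂ) 1 := by
    intro z hz
    rw [mem_ball_zero_iff, norm_inv]
    exact inv_lt_one_of_one_lt₀ hz
  have hf0 : ∀ u ∈ ball (0 : ℂ) 1, u ≠ 0 → f u ≠ 0 := by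
    intro u hu hu0
    rw [hf u hu hu0]
    exact inv_ne_zero (hne _ (hH.mapsTo (hinv u hu hu0)))
  refine ⟨?_, ?_, ?_⟩
  · intro u hu
    rcases eq_or_ne u 0 with rfl | hu0
    · rwa [h0]
    · rw [hf u hu hu0]
      exact hball _ (hH.mapsTo (hinv u hu hu0))
  · intro u hu v hv h
    rcases eq_or_ne u 0 with rfl | hu0
    · by_contra hv0
      exact hf0 v hv (Ne.symm hv0) (h.symm.trans h0)
    rcases eq_or_ne v 0 with rfl | hv0
    · exact absurd (h.trans h0) (hf0 u hu hu0)
    rw [hf u hu hu0, hf v hv hv0] at h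
    exact inv_injective (hH.injOn (hinv u hu hu0) (hinv v hv hv0) (inv_injective h))
  · intro v hv
    rcases eq_or_ne v 0 with rfl | hv0
    · exact ⟨0, hv, h0⟩
    obtain ⟨z, hz, hzv⟩ := hH.surjOn (hinv v hv hv0)
    refine ⟨z⁻¹, hball z hz, ?_⟩
    rw [hf _ (hball z hz) (inv_ne_zero (hne z hz)), inv_inv, hzv, inv_inv]

open Set Metric Topology Complex in
theorem exp_eq_inv_of_exterior_map {a c : ℝ} (ha : 0 < a) (ha1 : a < 1) {F : ℂ → ℂ}
    (hd : DifferentiableOn ℂ F {z : ℂ | 1 < ‖z‖})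
    (hb : BijOn F {z : ℂ | 1 < ‖z‖}
      {z : ℂ | 1 < ‖z‖ ∧ 2 * z.re < a * (Complex.normSq z + 1)})
    {M : ℝ} (hM : ∀ z : ℂ, 1 < ‖z‖ → ‖F z - Real.exp c * z‖ ≤ M) :
    Real.exp c = a⁻¹ := by
  set p : ℂ → ℂ := Function.update (fun u => u * F u⁻¹) 0 (Real.exp c : ℂ) with hp
  have hp0 : p 0 = (Real.exp c : ℂ) := by simp [hp]
  have hpu : ∀ u, u ≠ 0 → p u = u * F u⁻¹ := fun u hu => by simp [hp, hu]
  have hinv : ∀ u ∈ ball (0 : ℂ) 1, u ≠ 0 → 1 < ‖u⁻¹‖ := by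
    intro u hu hu0
    rw [norm_inv]
    exact (one_lt_inv₀ (norm_pos_iff.2 hu0)).2 (by simpa using hu)
  have ha0 : (a : ℂ) ≠ 0 := by exact_mod_cast ha.ne'
  have hexp : (Real.exp c : ℂ) ≠ 0 := by exact_mod_cast (Real.exp_pos c).ne'
  have hpd : DifferentiableOn ℂ p (ball 0 1) := by
    rw [← differentiableOn_compl_singleton_and_continuousAt_iff (ball_mem_nhds 0 one_pos)]
    constructor
    · have : DifferentiableOn ℂ (fun u : ℂ => u * F u⁻¹) (ball 0 1 \ {0}) := by
        refine differentiableOn_id.mul (hd.comp (differentiableOn_inv.mono ?_) ?_)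
        · exact fun u hu => hu.2
        · exact fun u hu => hinv u hu.1 hu.2
      exact this.congr fun u hu => hpu u hu.2
    · rw [continuousAt_iff_punctured_nhds, hp0, tendsto_iff_norm_sub_tendsto_zero]
      have hlim : Filter.Tendsto (fun u : ℂ => ‖u‖ * M) (𝓝[≠] 0) (𝓝 0) := by
        have : Filter.Tendsto (fun u : ℂ => ‖u‖ * M) (𝓝 0) (𝓝 (‖(0 : ℂ)‖ * M)) :=
          (by fun_prop : Continuous fun u : ℂ => ‖u‖ * M).tendsto 0
        rw [norm_zero, zero_mul] at this
        exact this.mono_left nhdsWithin_le_nhds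
      refine squeeze_zero' (Filter.Eventually.of_forall fun _ => norm_nonneg _) ?_ hlim
      filter_upwards [self_mem_nhdsWithin, nhdsWithin_le_nhds (ball_mem_nhds (0 : ℂ) one_pos)]
        with u hu0 hu
      have h1 : p u - Real.exp c = u * (F u⁻¹ - Real.exp c * u⁻¹) := by
        rw [hpu u hu0]
        field_simp [show u ≠ 0 from hu0]
      rw [h1, norm_mul]
      gcongr
      exact hM _ (hinv u hu hu0)
  have hFmem : ∀ u ∈ ball (0 : ℂ) 1, u ≠ 0 → F u⁻¹ ≠ 0 ∧ F u⁻¹ - a ≠ 0 ∧ a * F u⁻¹ - 1 ≠ 0 := by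
    intro u hu hu0
    have h1 : 1 < ‖F u⁻¹‖ := (hb.mapsTo (hinv u hu hu0)).1
    have h2 := (bijOn_cluster_map ha ha1).mapsTo (hb.mapsTo (hinv u hu hu0))
    simp only [mem_ofPred_eq] at h2
    refine ⟨?_, ?_, ?_⟩ <;> intro h
    · rw [h] at h1; norm_num at h1
    · rw [h] at h2; norm_num at h2
    · rw [h] at h2; norm_num at h2
  have hne : ∀ u ∈ ball (0 : ℂ) 1, p u ≠ 0 ∧ p u - a * u ≠ 0 ∧ a * p u - u ≠ 0 := by
    intro u hu
    rcases eq_or_ne u 0 with rfl | hu0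
    · simp [hp0, ha0]
    · obtain ⟨h1, h2, h3⟩ := hFmem u hu hu0
      rw [hpu u hu0]
      refine ⟨mul_ne_zero hu0 h1, ?_, ?_⟩
      · convert mul_ne_zero hu0 h2 using 1; ring
      · convert mul_ne_zero hu0 h3 using 1; ring
  set q : ℂ → ℂ := fun u => (p u - a * u) / (p u * (a * p u - u)) with hq
  have hqd : DifferentiableOn ℂ q (ball 0 1) :=
    (hpd.sub (differentiableOn_id.const_mul _)).div
      (hpd.mul ((hpd.const_mul _).sub differentiableOn_id))
      fun u hu => mul_ne_zero (hne u hu).1 (hne u hu).2.2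
  have hq1 := norm_zero_eq_one_of_bijOn_ball hqd
    (fun u hu => div_ne_zero (hne u hu).2.1 (mul_ne_zero (hne u hu).1 (hne u hu).2.2))
    (bijOn_ball_of_bijOn_exterior ((bijOn_cluster_map ha ha1).comp hb) (by simp) (by
      intro u hu hu0
      obtain ⟨h1, h2, h3⟩ := hFmem u hu hu0
      simp only [hq, Function.comp_apply, hpu u hu0]
      rw [show u * F u⁻¹ - a * u = u * (F u⁻¹ - a) by ring,
        show a * (u * F u⁻¹) - u = u * (a * F u⁻¹ - 1) by ring]
      field_simp))
  have hq0 : q 0 = ((a * Real.exp c)⁻¹ : ℝ) := by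
    simp only [hq, hp0]
    push_cast at hexp ⊢
    field_simp
    simp [mul_comm]
  rw [hq0, Complex.norm_real, Real.norm_of_nonneg (by positivity), inv_eq_one] at hq1
  exact eq_inv_of_mul_eq_one_right hq1

/-- For δ ∈ (0,1/3], r = δ/(2-δ), the logarithmic capacity of `K₀ ∪ P₁`, where
`P₁ = {z ∈ D₀ : |z-1| ≤ r|z+1|}`, equals `log((1+r²)/(1-r²))` and is at most `3δ²/4`. -/
theorem stmt1 (δ : ℝ) (hδ : δ ∈ Set.Ioc (0:ℝ) (1/3)) :
    let r : ℝ := δ / (2 - δ)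
    let P₁ : Set ℂ := {z : ℂ | 1 < ‖z‖ ∧ ‖z - 1‖ ≤ r * ‖z + 1‖}
    let K : Set ℂ := Metric.closedBall (0:ℂ) 1 ∪ P₁
    (∀ (c : ℝ) (F : ℂ → ℂ), IsNormalizedExteriorMap K c F →
      c = Real.log ((1 + r^2) / (1 - r^2))) ∧
    Real.log ((1 + r^2) / (1 - r^2)) ≤ 3 * δ^2 / 4 := by
  intro r P₁ K
  obtain ⟨h0, h1⟩ := hδ
  have hr0 : 0 < r := div_pos h0 (by linarith)
  have hr1 : r < 1 := (div_lt_one (by linarith)).2 (by linarith)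
  have hr2 : 0 < 1 - r ^ 2 := by nlinarith
  constructor
  · rintro c F ⟨hd, hb, M, hM⟩
    have hK : Kᶜ = {z : ℂ | 1 < ‖z‖ ∧
        2 * z.re < (1 - r ^ 2) / (1 + r ^ 2) * (Complex.normSq z + 1)} :=
      Set.ext fun z => compl_closedBall_union_iff hr0.le z
    rw [hK] at hb
    have hc := exp_eq_inv_of_exterior_map (div_pos hr2 (by positivity))
      ((div_lt_one (by positivity)).2 (by nlinarith)) hd hb hM
    rw [inv_div] at hc
    rw [← hc, Real.log_exp]
  · have h2 : (1 + r ^ 2) / (1 - r ^ 2) = 1 + δ ^ 2 / (2 * (1 - δ)) := by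
      have h3 : (2 - δ) ≠ 0 := by linarith
      have h4 : (1 - δ) ≠ 0 := by linarith
      rw [div_eq_iff hr2.ne']
      simp only [r]
      field_simp
      ring
    refine (Real.log_le_sub_one_of_pos (by positivity)).trans ?_
    rw [h2, add_sub_cancel_left, div_le_div_iff₀ (by linarith) (by norm_num)]
    nlinarith [sq_nonneg δ]
end

section
/- Let P ⊆ {z : |z-1| ≤ δ} be a connected particle attached to the unit circle, symmetric under conjugation, with 1+δ ∈ P, and let K = K₀ ∪ P, δ ∈ (0,1/3]. Then the logarithmic capacity c = cap(K) satisfies δ²/6 ≤ c ≤ 3δ²/4. -/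
open Filter Topology Set Bornology in
theorem not_eventually_eq_const_of_injOn {U : Set ℂ} (hU : IsOpen U) {f : ℂ → ℂ}
    (hinj : InjOn f U) {z : ℂ} (hz : z ∈ U) : ¬ ∀ᶠ w in 𝓝 z, f w = f z := by
  intro h
  have h1 : ∀ᶠ w in 𝓝[≠] z, False := by
    filter_upwards [nhdsWithin_le_nhds h, nhdsWithin_le_nhds (hU.mem_nhds hz),
      self_mem_nhdsWithin] with w hw hwU hne
    exact hne (hinj hwU hz hw)
  simpa using h1.exists

open Filter Topology Set Bornology in
theorem nhds_le_map_nhds_of_injOn {U : Set ℂ} (hU : IsOpen U) {f : ℂ → ℂ}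
    (hf : DifferentiableOn ℂ f U) (hinj : InjOn f U) {z : ℂ} (hz : z ∈ U) :
    𝓝 (f z) ≤ map f (𝓝 z) :=
  ((hf.analyticOnNhd hU z hz).eventually_constant_or_nhds_le_map_nhds).resolve_left
    (not_eventually_eq_const_of_injOn hU hinj hz)

open Filter Topology Set Bornology in
theorem isOpen_image_of_injOn {U : Set ℂ} (hU : IsOpen U) {f : ℂ → ℂ}
    (hf : DifferentiableOn ℂ f U) (hinj : InjOn f U) : IsOpen (f '' U) := by
  rw [isOpen_iff_mem_nhds]
  rintro _ ⟨z, hz, rfl⟩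
  exact nhds_le_map_nhds_of_injOn hU hf hinj hz (image_mem_map (hU.mem_nhds hz))

open Filter Topology Set Bornology in
theorem eventually_deriv_ne_zero_of_injOn {U : Set ℂ} (hU : IsOpen U) {f : ℂ → ℂ}
    (hf : DifferentiableOn ℂ f U) (hinj : InjOn f U) {z : ℂ} (hz : z ∈ U) :
    ∀ᶠ w in 𝓝[≠] z, deriv f w ≠ 0 := by
  refine (((hf.analyticOnNhd hU).deriv z hz).eventually_eq_zero_or_eventually_ne_zero).resolve_left
    fun h => not_eventually_eq_const_of_injOn hU hinj hz ?_
  obtain ⟨r, hr, hball⟩ := Metric.mem_nhds_iff.1 (inter_mem h (hU.mem_nhds hz))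
  obtain ⟨a, ha⟩ := Metric.isOpen_ball.exists_is_const_of_deriv_eq_zero
    (convex_ball z r).isPreconnected (hf.mono fun w hw => (hball hw).2) fun w hw => (hball hw).1
  filter_upwards [Metric.ball_mem_nhds z hr] with w hw
  rw [ha w hw, ha z (Metric.mem_ball_self hr)]

open Filter Topology Set Bornology in
/-- The inverse of an injective holomorphic function is holomorphic. -/
theorem differentiableOn_invFunOn {U : Set ℂ} (hU : IsOpen U) {f : ℂ → ℂ}
    (hf : DifferentiableOn ℂ f U) (hinj : InjOn f U) :
    DifferentiableOn ℂ (Function.invFunOn f U) (f '' U) := by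
  have hopen := isOpen_image_of_injOn hU hf hinj
  have hleft : ∀ z ∈ U, Function.invFunOn f U (f z) = z := fun z hz =>
    hinj.leftInvOn_invFunOn hz
  have hcont : ∀ z ∈ U, ContinuousAt (Function.invFunOn f U) (f z) := by
    intro z hz
    have h1 : Tendsto (Function.invFunOn f U) (map f (𝓝 z)) (𝓝 z) := by
      rw [tendsto_map'_iff]
      refine tendsto_id.congr' ?_
      filter_upwards [hU.mem_nhds hz] with w hw
      exact (hleft w hw).symm
    rw [ContinuousAt, hleft z hz]
    exact h1.mono_left (nhds_le_map_nhds_of_injOn hU hf hinj hz)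
  have hdiff : ∀ z ∈ U, deriv f z ≠ 0 →
      DifferentiableAt ℂ (Function.invFunOn f U) (f z) := by
    intro z hz hd
    refine (HasDerivAt.of_local_left_inverse (f := f) (f' := deriv f z) (hcont z hz) ?_ hd ?_
      ).differentiableAt
    · rw [hleft z hz]
      exact (hf.differentiableAt (hU.mem_nhds hz)).hasDerivAt
    · filter_upwards [hopen.mem_nhds (mem_image_of_mem f hz)] with y hy
      exact Function.invFunOn_eq hy
  rintro _ ⟨z, hz, rfl⟩
  refine (Complex.analyticAt_of_differentiable_on_punctured_nhds_of_continuousAt (c := f z) ?_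
    (hcont z hz)).differentiableAt.differentiableWithinAt
  have h2 := (eventually_nhdsWithin_iff.1 (eventually_deriv_ne_zero_of_injOn hU hf hinj hz))
  have h3 := (hcont z hz).tendsto
  rw [hleft z hz] at h3
  filter_upwards [nhdsWithin_le_nhds (h3.eventually h2), self_mem_nhdsWithin,
    nhdsWithin_le_nhds (hopen.mem_nhds (mem_image_of_mem f hz))] with y hy hne hyU
  obtain ⟨w, hw, rfl⟩ := hyU
  rw [hleft w hw] at hy
  exact hdiff w hw (hy fun h => hne (by rw [mem_singleton_iff.1 h]; rfl))

open Set in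
theorem isOpen_one_lt_norm : IsOpen {z : ℂ | 1 < ‖z‖} :=
  isOpen_lt continuous_const continuous_norm

open Filter Topology Set Bornology in
/-- Maximum principle on the exterior of the unit disc. -/
theorem norm_le_one_of_exterior {f : ℂ → ℂ} {l : ℂ}
    (hf : DifferentiableOn ℂ f {z : ℂ | 1 < ‖z‖})
    (hbd : ∀ ε > 0, ∃ r > 1, ∀ z : ℂ, 1 < ‖z‖ → ‖z‖ < r → ‖f z‖ ≤ 1 + ε)
    (hl : Tendsto f (cobounded ℂ) (𝓝 l)) :
    ‖l‖ ≤ 1 ∧ (‖l‖ = 1 → ∀ z : ℂ, 1 < ‖z‖ → f z = l) := by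
  set g : ℂ → ℂ := Function.update (fun u => f u⁻¹) 0 l with hg
  have hg0 : g 0 = l := by simp [hg]
  have hgne : ∀ u ≠ 0, g u = f u⁻¹ := fun u hu => by simp [hg, hu]
  have hinv : ∀ u : ℂ, u ≠ 0 → u ∈ Metric.ball (0 : ℂ) 1 → 1 < ‖u⁻¹‖ := by
    intro u hu hu1
    rw [norm_inv]
    exact (one_lt_inv₀ (norm_pos_iff.2 hu)).2 (by simpa using hu1)
  have hgd : DifferentiableOn ℂ g (Metric.ball 0 1) := by
    rw [← Complex.differentiableOn_compl_singleton_and_continuousAt_iff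
      (Metric.ball_mem_nhds (0 : ℂ) one_pos)]
    constructor
    · have : DifferentiableOn ℂ (fun u : ℂ => f u⁻¹) (Metric.ball 0 1 \ {0}) :=
        hf.comp (differentiableOn_inv.mono fun u hu => hu.2) fun u hu => hinv u hu.2 hu.1
      exact this.congr fun u hu => hgne u hu.2
    · rw [hg, continuousAt_update_same]
      exact hl.comp tendsto_inv₀_nhdsNE_zero
  have hle : ∀ u ∈ Metric.ball (0 : ℂ) 1, ‖g u‖ ≤ 1 := by
    intro u hu
    refine le_of_forall_pos_le_add fun ε hε => ?_
    obtain ⟨r, hr, h⟩ := hbd ε hε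
    have hu1 : ‖u‖ < 1 := by simpa using hu
    have hr1 : r⁻¹ < 1 := inv_lt_one_of_one_lt₀ hr
    obtain ⟨ρ, hρ, hρ1⟩ := exists_between (max_lt hu1 hr1)
    have hρ0 : 0 < ρ := (norm_nonneg u).trans_lt ((le_max_left _ _).trans_lt hρ)
    refine Complex.norm_le_of_forall_mem_frontier_norm_le (U := Metric.ball 0 ρ)
      Metric.isBounded_ball (DifferentiableOn.diffContOnCl ?_) ?_
      (subset_closure (by simpa using (le_max_left _ _).trans_lt hρ))
    · rw [closure_ball _ hρ0.ne']
      exact hgd.mono (Metric.closedBall_subset_ball hρ1)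
    · intro v hv
      rw [frontier_ball _ hρ0.ne', mem_sphere_zero_iff_norm] at hv
      have hv0 : v ≠ 0 := by rw [← norm_pos_iff, hv]; exact hρ0
      rw [hgne v hv0]
      refine h _ (hinv v hv0 (by simpa [hv] using hρ1)) ?_
      rw [norm_inv, hv]
      exact inv_lt_of_inv_lt₀ (by linarith) ((le_max_right _ _).trans_lt hρ)
  have h0 : (0 : ℂ) ∈ Metric.ball (0 : ℂ) 1 := by simp
  refine ⟨hg0 ▸ hle 0 h0, fun h1 z hz => ?_⟩
  have hz0 : z ≠ 0 := by rintro rfl; simp at hz; linarith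
  have := Complex.eqOn_of_isPreconnected_of_isMaxOn_norm (convex_ball (0 : ℂ) 1).isPreconnected
    Metric.isOpen_ball hgd h0 (fun u hu => by simpa [hg0, h1] using hle u hu)
    (x := z⁻¹) (by simpa using inv_lt_one_of_one_lt₀ hz)
  simpa [hg0, hgne _ (inv_ne_zero hz0)] using this

open Filter Topology Set Bornology in
theorem eventually_cobounded_one_lt_norm : ∀ᶠ z in cobounded ℂ, 1 < ‖z‖ :=
  tendsto_norm_cobounded_atTop.eventually_gt_atTop 1

open Filter Topology Bornology in
theorem tendsto_cobounded_of_tendsto_div {g : ℂ → ℂ} {l : ℂ} (hl : l ≠ 0)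
    (hg : Tendsto (fun z => g z / z) (cobounded ℂ) (𝓝 l)) :
    Tendsto g (cobounded ℂ) (cobounded ℂ) := by
  rw [← tendsto_norm_atTop_iff_cobounded]
  have h := hg.norm.pos_mul_atTop (norm_pos_iff.2 hl) tendsto_norm_cobounded_atTop
  refine h.congr' ?_
  filter_upwards [eventually_cobounded_one_lt_norm] with z hz
  rw [norm_div, div_mul_cancel₀]
  linarith

namespace IsNormalizedExteriorMap

variable {K : Set ℂ} {c : ℝ} {F : ℂ → ℂ}

open Filter Topology Set Bornology in
theorem tendsto_div (hF : IsNormalizedExteriorMap K c F) :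
    Tendsto (fun z => F z / z) (cobounded ℂ) (𝓝 (Real.exp c : ℂ)) := by
  obtain ⟨-, -, M, hM⟩ := hF
  rw [tendsto_iff_norm_sub_tendsto_zero]
  have h : Tendsto (fun z : ℂ => M * ‖z‖⁻¹) (cobounded ℂ) (𝓝 0) := by
    simpa using (tendsto_norm_cobounded_atTop.inv_tendsto_atTop).const_mul M
  refine tendsto_of_tendsto_of_tendsto_of_le_of_le' tendsto_const_nhds h
    (Eventually.of_forall fun _ => norm_nonneg _) ?_
  filter_upwards [eventually_cobounded_one_lt_norm] with z hz
  have hz0 : z ≠ 0 := by rintro rfl; simp at hz; linarith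
  rw [show F z / z - (Real.exp c : ℂ) = (F z - Real.exp c * z) * z⁻¹ by field_simp, norm_mul,
    norm_inv]
  gcongr
  exact hM z hz

open Filter Topology Set Bornology in
theorem tendsto_cobounded (hF : IsNormalizedExteriorMap K c F) :
    Tendsto F (cobounded ℂ) (cobounded ℂ) :=
  tendsto_cobounded_of_tendsto_div (by simp) hF.tendsto_div

open Filter Topology Set Bornology in
/-- Points close to the unit circle are mapped close to the boundary of `K`. -/
theorem exists_forall_mem (hF : IsNormalizedExteriorMap K c F) {V : Set ℂ} (hV : IsOpen V)
    (hKV : K ∩ closure Kᶜ ⊆ V) :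
    ∃ r > 1, ∀ z : ℂ, 1 < ‖z‖ → ‖z‖ < r → F z ∈ V := by
  obtain ⟨hd, hbij, M, hM⟩ := hF
  by_contra! h
  choose z hz1 hz2 hz3 using fun n : ℕ => h (1 + 1 / ((n : ℝ) + 1)) (by
    have : 0 < 1 / ((n : ℝ) + 1) := by positivity
    linarith)
  have hlim : Tendsto (fun n => ‖z n‖) atTop (𝓝 1) := by
    refine tendsto_of_tendsto_of_tendsto_of_le_of_le tendsto_const_nhds
      (h := fun n : ℕ => 1 + 1 / ((n : ℝ) + 1)) ?_ (fun n => (hz1 n).le) fun n => (hz2 n).le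
    simpa using tendsto_one_div_add_atTop_nhds_zero_nat.const_add (1 : ℝ)
  have hbdd : ∀ n, F (z n) ∈ Metric.closedBall (0 : ℂ) (M + Real.exp c * 2) := by
    intro n
    have h2 : ‖z n‖ ≤ 2 := by
      have : 1 / ((n : ℝ) + 1) ≤ 1 := by
        rw [div_le_one (by positivity)]; linarith [n.cast_nonneg (α := ℝ)]
      linarith [hz2 n]
    rw [mem_closedBall_zero_iff]
    calc ‖F (z n)‖ = ‖(F (z n) - Real.exp c * z n) + Real.exp c * z n‖ := by ring_nf
      _ ≤ M + ‖(Real.exp c : ℂ) * z n‖ := (norm_add_le _ _).trans (by gcongr; exact hM _ (hz1 n))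
      _ ≤ M + Real.exp c * 2 := by
        rw [norm_mul, Complex.norm_real, Real.norm_of_nonneg (Real.exp_pos c).le]; gcongr
  obtain ⟨w, -, φ, hφ, hw⟩ := tendsto_subseq_of_bounded Metric.isBounded_closedBall hbdd
  have hwV : w ∉ V := hV.isClosed_compl.mem_of_tendsto hw (Eventually.of_forall fun n => hz3 _)
  have hwcl : w ∈ closure Kᶜ :=
    mem_closure_of_tendsto hw (Eventually.of_forall fun n => hbij.mapsTo (hz1 _))
  have hwK : w ∈ Kᶜ := fun hwK => hwV (hKV ⟨hwK, hwcl⟩)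
  rw [← hbij.image_eq] at hwK
  have hcont := ((differentiableOn_invFunOn isOpen_one_lt_norm hd hbij.injOn).differentiableAt
    ((isOpen_image_of_injOn isOpen_one_lt_norm hd hbij.injOn).mem_nhds hwK)).continuousAt
  obtain ⟨z₀, hz₀, rfl⟩ := hwK
  have h1 := hcont.tendsto.comp hw
  rw [hbij.injOn.leftInvOn_invFunOn hz₀] at h1
  have h2 : Tendsto (fun n => z (φ n)) atTop (𝓝 z₀) :=
    h1.congr fun n => hbij.injOn.leftInvOn_invFunOn (hz1 (φ n))
  have h3 := tendsto_nhds_unique h2.norm (hlim.comp hφ.tendsto_atTop)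
  exact (ne_of_gt hz₀) h3

open Filter Topology Set Bornology in
/-- The normalized exterior map of a set is unique. -/
theorem eqOn {F₁ F₂ : ℂ → ℂ} (h₁ : IsNormalizedExteriorMap K c F₁)
    (h₂ : IsNormalizedExteriorMap K c F₂) : EqOn F₁ F₂ {z | 1 < ‖z‖} := by
  obtain ⟨hd₂, hb₂, -⟩ := id h₂
  set G : ℂ → ℂ := fun z => Function.invFunOn F₂ {z | 1 < ‖z‖} (F₁ z) with hG
  have himg : ∀ z : ℂ, 1 < ‖z‖ → F₁ z ∈ F₂ '' {z | 1 < ‖z‖} := fun z hz => by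
    rw [hb₂.image_eq]; exact h₁.2.1.mapsTo hz
  have hGm : ∀ z : ℂ, 1 < ‖z‖ → 1 < ‖G z‖ := fun z hz => Function.invFunOn_mem (himg z hz)
  have hGe : ∀ z : ℂ, 1 < ‖z‖ → F₂ (G z) = F₁ z := fun z hz => Function.invFunOn_eq (himg z hz)
  have hGd : DifferentiableOn ℂ G {z | 1 < ‖z‖} :=
    (differentiableOn_invFunOn isOpen_one_lt_norm hd₂ hb₂.injOn).comp h₁.1 himg
  have hGc : Tendsto G (cobounded ℂ) (cobounded ℂ) := by
    have hcpt : ∀ R : ℝ, ∀ᶠ z in cobounded ℂ, R < ‖G z‖ := by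
      intro R
      obtain ⟨M, hM⟩ := h₂.2.2
      filter_upwards [eventually_cobounded_one_lt_norm, (tendsto_norm_cobounded_atTop.comp
        h₁.tendsto_cobounded).eventually_gt_atTop (M + Real.exp c * R)] with z hz hz2
      by_contra! hle
      have h3 : ‖F₂ (G z)‖ ≤ M + Real.exp c * R := by
        calc ‖F₂ (G z)‖ = ‖(F₂ (G z) - Real.exp c * G z) + Real.exp c * G z‖ := by ring_nf
          _ ≤ M + ‖(Real.exp c : ℂ) * G z‖ :=
            (norm_add_le _ _).trans (by gcongr; exact hM _ (hGm z hz))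
          _ ≤ M + Real.exp c * R := by
            rw [norm_mul, Complex.norm_real, Real.norm_of_nonneg (Real.exp_pos c).le]; gcongr
      rw [hGe z hz] at h3
      exact absurd hz2 (not_lt.2 h3)
    rw [← tendsto_norm_atTop_iff_cobounded, tendsto_atTop]
    exact fun R => (hcpt R).mono fun z hz => hz.le
  have hlim : Tendsto (fun z => z / G z) (cobounded ℂ) (𝓝 1) := by
    have h3 := (h₂.tendsto_div.comp hGc).div h₁.tendsto_div (by simp)
    rw [div_self (by simp)] at h3
    refine h3.congr' ?_
    filter_upwards [eventually_cobounded_one_lt_norm,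
      h₁.tendsto_cobounded.eventually eventually_cobounded_one_lt_norm] with z hz hz2
    have hz0 : F₁ z ≠ 0 := by rw [← norm_pos_iff]; linarith
    simp only [Function.comp_apply, Pi.div_apply, hGe z hz]
    field_simp
  have hne : ∀ z : ℂ, 1 < ‖z‖ → G z ≠ 0 := fun z hz => by
    rw [← norm_pos_iff]; linarith [hGm z hz]
  have h4 := (norm_le_one_of_exterior (f := fun z => z / G z)
    (differentiableOn_id.div hGd hne) (fun ε hε => ⟨1 + ε, by linarith, fun z hz hzr => by
      rw [norm_div, div_le_iff₀ (by linarith [hGm z hz])]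
      nlinarith [hGm z hz]⟩) hlim).2 (by simp)
  intro z hz
  have h5 : z / G z = 1 := h4 z hz
  rw [div_eq_one_iff_eq (hne z hz)] at h5
  rw [← hGe z hz, ← h5]

open Set in
open scoped ComplexConjugate in
theorem conj_conj (hF : IsNormalizedExteriorMap K c F) (hK : ∀ z ∈ K, conj z ∈ K) :
    IsNormalizedExteriorMap K c (fun z => conj (F (conj z))) := by
  have hKc : ∀ z ∈ Kᶜ, conj z ∈ Kᶜ := fun z hz h => hz (by simpa using hK _ h)
  obtain ⟨hd, hb, M, hM⟩ := hF
  have hm : ∀ z : ℂ, 1 < ‖z‖ → 1 < ‖conj z‖ := fun z hz => by simpa using hz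
  refine ⟨fun z hz => ?_, ⟨fun z hz => hKc _ (hb.mapsTo (hm z hz)), fun z hz w hw h => ?_,
    fun w hw => ?_⟩, M, fun z hz => ?_⟩
  · have h1 := hd.differentiableAt (isOpen_one_lt_norm.mem_nhds (hm z hz))
    exact (differentiableAt_conj_conj_iff.2 h1).differentiableWithinAt
  · exact (starRingEnd ℂ).injective
      (hb.injOn (hm z hz) (hm w hw) ((starRingEnd ℂ).injective h))
  · obtain ⟨z, hz, hzw⟩ := hb.surjOn (hKc w hw)
    exact ⟨conj z, hm z hz, by simp [hzw]⟩
  · have h1 := hM _ (hm z hz)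
    rw [← RCLike.norm_conj] at h1
    rwa [map_sub, map_mul, Complex.conj_conj, Complex.conj_ofReal] at h1

open Set in
open scoped ComplexConjugate in
theorem map_conj (hF : IsNormalizedExteriorMap K c F) (hK : ∀ z ∈ K, conj z ∈ K) {z : ℂ}
    (hz : 1 < ‖z‖) : F (conj z) = conj (F z) := by
  have h := (hF.conj_conj hK).eqOn hF (x := z) hz
  simpa using congrArg conj h

open Set in
/-- If `K` is symmetric under conjugation, then its intersection with the real axis is convex. -/
theorem ofReal_mem_of_symm (hF : IsNormalizedExteriorMap K c F)
    (hK : ∀ z ∈ K, (starRingEnd ℂ) z ∈ K) {a b x : ℝ} (ha : (a : ℂ) ∈ K) (hb : (b : ℂ) ∈ K)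
    (hx : x ∈ Icc a b) : (x : ℂ) ∈ K := by
  by_contra hxK
  obtain ⟨z, hz, hzx⟩ := hF.2.1.surjOn hxK
  have hreal : ∀ t : ℝ, 1 < |t| → F t = ((F t).re : ℂ) := fun t ht => by
    have h := hF.map_conj hK (z := t) (by simpa using ht)
    rw [Complex.conj_ofReal] at h
    exact (Complex.conj_eq_iff_re.1 h.symm).symm
  have hnot : ∀ t : ℝ, 1 < |t| → ∀ y : ℝ, (y : ℂ) ∈ K → (F t).re ≠ y := fun t ht y hy h => by
    refine hF.2.1.mapsTo (x := (t : ℂ)) (by simpa using ht) ?_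
    rwa [hreal t ht, h]
  have hcont : ∀ s : Set ℝ, (∀ t ∈ s, 1 < |t|) → ContinuousOn (fun t : ℝ => (F t).re) s :=
    fun s hs => Complex.continuous_re.comp_continuousOn (hF.1.continuousOn.comp
      Complex.continuous_ofReal.continuousOn fun t ht => by simpa using hs t ht)
  have hzconj : (starRingEnd ℂ) z = z := by
    refine hF.2.1.injOn (by simpa using hz) hz ?_
    rw [hF.map_conj hK hz, hzx, Complex.conj_ofReal]
  obtain ⟨t, rfl⟩ := Complex.conj_eq_iff_real.1 hzconj
  have ht : 1 < |t| := by simpa using hz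
  have htx : (F t).re = x := by simp [hzx]
  have hxa : a < x := hx.1.lt_of_ne fun h => hnot t ht a ha (by rw [htx, h])
  have hxb : x < b := hx.2.lt_of_ne fun h => hnot t ht b hb (by rw [htx, h])
  obtain ⟨M, hM⟩ := hF.2.2
  have hM' : ∀ s : ℝ, 1 < |s| → |(F s).re - Real.exp c * s| ≤ M := fun s hs => by
    refine le_trans ?_ (hM s (by simpa using hs))
    simpa [-Complex.ofReal_exp] using Complex.abs_re_le_norm (F s - Real.exp c * s)
  have hexp := Real.exp_pos c
  rcases lt_abs.1 ht with ht1 | ht1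
  · set T := max t ((b + M) / Real.exp c)
    have hseg : ∀ s ∈ Icc t T, 1 < |s| := fun s hs => lt_abs.2 (Or.inl (ht1.trans_le hs.1))
    have hT := (abs_le.1 (hM' T (hseg T ⟨le_max_left _ _, le_rfl⟩))).1
    have hT2 : b + M ≤ Real.exp c * T := by
      rw [mul_comm, ← div_le_iff₀ hexp]; exact le_max_right _ _
    obtain ⟨s, hs, hsb⟩ := intermediate_value_Icc (le_max_left _ _) (hcont _ hseg)
      (show b ∈ Icc (F t).re (F T).re from ⟨by linarith, by linarith⟩)
    exact hnot s (hseg s hs) b hb hsb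
  · set T := min t ((a - M) / Real.exp c)
    have hseg : ∀ s ∈ Icc T t, 1 < |s| := fun s hs => lt_abs.2 (Or.inr (by linarith [hs.2]))
    have hT := (abs_le.1 (hM' T (hseg T ⟨le_rfl, min_le_left _ _⟩))).2
    have hT2 : Real.exp c * T ≤ a - M := by
      rw [mul_comm, ← le_div_iff₀ hexp]; exact min_le_right _ _
    obtain ⟨s, hs, hsa⟩ := intermediate_value_Icc (min_le_left _ _) (hcont _ hseg)
      (show a ∈ Icc (F T).re (F t).re from ⟨by linarith, by linarith⟩)
    exact hnot s (hseg s hs) a ha hsa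

end IsNormalizedExteriorMap

/-- The inverse of the Joukowski map `w ↦ w + w⁻¹`, from the complement of `[-2, 2]` to the
exterior of the unit disc. -/
noncomputable def joukowskiInv (u : ℂ) : ℂ := u * (1 + Complex.sqrt (1 - 4 / u ^ 2)) / 2

theorem Complex.sqrt_re_pos {x : ℂ} (hx : x ∈ Complex.slitPlane) : 0 < (Complex.sqrt x).re := by
  rw [Complex.sqrt, Complex.cpow_inv_two_re, Real.sqrt_pos]
  rcases Complex.mem_slitPlane_iff.1 hx with h | h
  · linarith [norm_nonneg x]
  · linarith [neg_abs_le x.re, Complex.abs_re_lt_norm.2 h]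

theorem one_sub_four_div_sq_mem_slitPlane {u : ℂ}
    (hu : ∀ x : ℝ, -2 ≤ x → x ≤ 2 → u ≠ x) : 1 - 4 / u ^ 2 ∈ Complex.slitPlane := by
  have hu0 : u ≠ 0 := by simpa using hu 0 (by norm_num) (by norm_num)
  by_contra h
  rw [Complex.mem_slitPlane_iff] at h
  push Not at h
  set t : ℝ := -(1 - 4 / u ^ 2).re with ht
  have ht0 : 0 ≤ t := by linarith [h.1]
  have h1 : 1 - 4 / u ^ 2 = ((-t : ℝ) : ℂ) := Complex.ext (by simp [ht]) (by simpa using h.2)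
  set r : ℝ := 2 / √(1 + t) with hr
  have hr0 : 0 ≤ r := by positivity
  have hrt : r ^ 2 * (1 + t) = 4 := by
    rw [hr, div_pow, Real.sq_sqrt (by linarith)]; field_simp; norm_num
  have hr2 : r ≤ 2 := by nlinarith
  have h2 : (u ^ 2 - (r : ℂ) ^ 2) * (1 + t) = 0 := by
    have h3 : (r : ℂ) ^ 2 * (1 + t) = 4 := by exact_mod_cast hrt
    have h4 : u ^ 2 * (1 + t) = 4 := by
      field_simp at h1
      push_cast at h1
      linear_combination h1
    linear_combination h4 - h3
  have h5 : (1 + t : ℂ) ≠ 0 := by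
    have : (1 + t : ℝ) ≠ 0 := by linarith
    exact_mod_cast this
  have h6 : (u - r) * (u + r) = 0 := by
    rw [← (mul_eq_zero.1 h2).resolve_right h5]; ring
  rcases mul_eq_zero.1 h6 with h7 | h7
  · exact hu r (by linarith) hr2 (by linear_combination h7)
  · exact hu (-r) (by linarith) (by linarith) (by push_cast; linear_combination h7)

theorem differentiableAt_joukowskiInv {u : ℂ} (hu : ∀ x : ℝ, -2 ≤ x → x ≤ 2 → u ≠ x) :
    DifferentiableAt ℂ joukowskiInv u := by
  have hu0 : u ≠ 0 := by simpa using hu 0 (by norm_num) (by norm_num)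
  have h1 : DifferentiableAt ℂ (fun u : ℂ => 1 - 4 / u ^ 2) u := by
    fun_prop (disch := exact pow_ne_zero 2 hu0)
  have h2 := (Complex.differentiableAt_sqrt (one_sub_four_div_sq_mem_slitPlane hu)).comp u h1
  exact (differentiableAt_id.mul (h2.const_add 1)).div_const 2

theorem one_lt_norm_joukowskiInv {u : ℂ} (hu : ∀ x : ℝ, -2 ≤ x → x ≤ 2 → u ≠ x) :
    1 < ‖joukowskiInv u‖ := by
  have hu0 : u ≠ 0 := by simpa using hu 0 (by norm_num) (by norm_num)
  have hre := Complex.sqrt_re_pos (one_sub_four_div_sq_mem_slitPlane hu)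
  set s := Complex.sqrt (1 - 4 / u ^ 2) with hs
  have hsq : s ^ 2 = 1 - 4 / u ^ 2 := by
    rw [hs, Complex.sqrt]
    simpa only [Nat.cast_ofNat] using Complex.cpow_nat_inv_pow (1 - 4 / u ^ 2) two_ne_zero
  have hprod : joukowskiInv u * (u * (1 - s) / 2) = 1 := by
    have : joukowskiInv u * (u * (1 - s) / 2) = u ^ 2 * (1 - s ^ 2) / 4 := by
      rw [joukowskiInv, ← hs]; ring
    rw [this, hsq]
    field_simp
    ring
  have hlt : ‖1 - s‖ < ‖1 + s‖ := by
    rw [← sq_lt_sq₀ (norm_nonneg _) (norm_nonneg _), ← Complex.normSq_eq_norm_sq,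
      ← Complex.normSq_eq_norm_sq, Complex.normSq_apply, Complex.normSq_apply]
    simp only [Complex.sub_re, Complex.sub_im, Complex.add_re, Complex.add_im, Complex.one_re,
      Complex.one_im]
    nlinarith
  have hlt2 : ‖u * (1 - s) / 2‖ < ‖joukowskiInv u‖ := by
    rw [joukowskiInv, ← hs, norm_div, norm_div, norm_mul, norm_mul]
    have := norm_pos_iff.2 hu0
    have h2 : ‖(2 : ℂ)‖ = 2 := by simp
    rw [h2]
    gcongr
  have h1 := congrArg norm hprod
  rw [norm_mul, norm_one] at h1
  nlinarith [norm_nonneg (u * (1 - s) / 2), norm_nonneg (joukowskiInv u)]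

open Filter Topology Bornology in
theorem tendsto_joukowskiInv_div :
    Tendsto (fun u => joukowskiInv u / u) (cobounded ℂ) (𝓝 1) := by
  have h1 : Tendsto (fun u : ℂ => 1 - 4 * (u⁻¹) ^ 2) (cobounded ℂ) (𝓝 1) := by
    simpa using ((tendsto_inv₀_cobounded (α := ℂ)).pow 2).const_mul 4 |>.const_sub 1
  have h2 := (Complex.continuousAt_sqrt (z := 1) (by simp)).tendsto.comp h1
  have h3 := (h2.const_add 1).div_const 2
  rw [Complex.sqrt_one, one_add_one_eq_two, div_self two_ne_zero] at h3
  refine h3.congr' ?_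
  filter_upwards [eventually_cobounded_one_lt_norm] with u hu
  have hu0 : u ≠ 0 := by rintro rfl; simp at hu; linarith
  simp only [joukowskiInv, Function.comp_apply, inv_pow, ← div_eq_mul_inv]
  field_simp

namespace IsNormalizedExteriorMap

variable {K : Set ℂ} {c : ℝ} {F : ℂ → ℂ}

open Filter Topology Bornology in
theorem le_of_slit_subset (hF : IsNormalizedExteriorMap K c F) {δ : ℝ} (hδ : 0 ≤ δ)
    (hball : Metric.closedBall 0 1 ⊆ K) (hslit : ∀ x : ℝ, 1 ≤ x → x ≤ 1 + δ → (x : ℂ) ∈ K) :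
    (δ / (2 + δ)) ^ 2 ≤ c := by
  set κ : ℝ := 4 * (1 + δ) / (2 + δ) ^ 2 with hκ
  have hκ0 : 0 < κ := by positivity
  set A : ℂ → ℂ := fun w => (w + w⁻¹ - ((δ ^ 2 / (2 * (1 + δ)) : ℝ) : ℂ)) * κ with hA
  have hone : ∀ w ∉ K, 1 < ‖w‖ := fun w hw => by
    by_contra! h
    exact hw (hball (by simpa using h))
  have hne0 : ∀ w ∉ K, w ≠ 0 := fun w hw => by
    rw [← norm_pos_iff]; linarith [hone w hw]
  have hslit' : ∀ w ∉ K, ∀ x : ℝ, -2 ≤ x → x ≤ 2 → A w ≠ x := by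
    intro w hw x hx1 hx2 h
    have hw1 := hone w hw
    have hns : 1 < Complex.normSq w := by rw [Complex.normSq_eq_norm_sq]; nlinarith
    have him := congrArg Complex.im h
    simp only [hA, Complex.im_mul_ofReal, Complex.sub_im, Complex.add_im, Complex.inv_im,
      Complex.ofReal_im, sub_zero] at him
    have him2 := (mul_eq_zero.1 him).resolve_right hκ0.ne'
    have him3 : w.im * (Complex.normSq w - 1) = 0 := by
      field_simp at him2
      linarith
    have hwim : w.im = 0 := (mul_eq_zero.1 him3).resolve_right (by linarith)
    obtain ⟨y, rfl⟩ : ∃ y : ℝ, w = y := ⟨w.re, Complex.ext (by simp) (by simpa using hwim)⟩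
    have h2 : (y + y⁻¹ - δ ^ 2 / (2 * (1 + δ))) * κ = x := by
      simp only [hA] at h
      exact_mod_cast h
    have hy1 : 1 < |y| := by simpa using hw1
    have hy0 : y ≠ 0 := by rintro rfl; simp at hy1; linarith
    have hexpr : (y + y⁻¹ - δ ^ 2 / (2 * (1 + δ))) * κ
        = 2 + 4 * (y - (1 + δ)) * (y * (1 + δ) - 1) / (y * (2 + δ) ^ 2) := by
      rw [hκ]; field_simp; ring
    have hexpr2 : (y + y⁻¹ - δ ^ 2 / (2 * (1 + δ))) * κ
        = -2 + 4 * (1 + δ) * (y + 1) ^ 2 / (y * (2 + δ) ^ 2) := by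
      rw [hκ]; field_simp; ring
    rcases lt_abs.1 hy1 with hy | hy
    · have hyδ : 1 + δ < y := by
        by_contra! hle
        exact hw (hslit y hy.le hle)
      have : 0 < 4 * (y - (1 + δ)) * (y * (1 + δ) - 1) / (y * (2 + δ) ^ 2) := by
        have h3 : 0 < y - (1 + δ) := by linarith
        have h4 : 0 < y * (1 + δ) - 1 := by nlinarith
        positivity
      linarith
    · have : 4 * (1 + δ) * (y + 1) ^ 2 / (y * (2 + δ) ^ 2) < 0 := by
        have h3 : 0 < (y + 1) ^ 2 := by nlinarith
        refine div_neg_of_pos_of_neg (by positivity) (mul_neg_of_neg_of_pos (by linarith)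
          (by positivity))
      linarith
  have hAdiv : Tendsto (fun w => A w / w) (cobounded ℂ) (𝓝 (κ : ℂ)) := by
    have h1 : Tendsto (fun w : ℂ => (1 + w⁻¹ * w⁻¹ - ((δ ^ 2 / (2 * (1 + δ)) : ℝ) : ℂ) * w⁻¹) * κ)
        (cobounded ℂ) (𝓝 (κ : ℂ)) := by
      have h0 := tendsto_inv₀_cobounded (α := ℂ)
      simpa only [mul_zero, add_zero, sub_zero, one_mul] using
        (((h0.mul h0).const_add 1).sub (h0.const_mul ((δ ^ 2 / (2 * (1 + δ)) : ℝ) : ℂ))).mul_const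
          (κ : ℂ)
    refine h1.congr' ?_
    filter_upwards [eventually_cobounded_one_lt_norm] with w hw
    have hw0 : w ≠ 0 := by rintro rfl; simp at hw; linarith
    simp only [hA]
    field_simp
  have hκ0' : (κ : ℂ) ≠ 0 := by exact_mod_cast hκ0.ne'
  have hAc := tendsto_cobounded_of_tendsto_div hκ0' hAdiv
  have hlim : Tendsto (fun z => z / joukowskiInv (A (F z))) (cobounded ℂ)
      (𝓝 ((Real.exp (-c) / κ : ℝ) : ℂ)) := by
    have h1 := ((tendsto_joukowskiInv_div.comp (hAc.comp hF.tendsto_cobounded)).mul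
      (hAdiv.comp hF.tendsto_cobounded)).mul hF.tendsto_div
    have h2 := h1.inv₀ (by simpa using hκ0')
    have h3 : (1 * (κ : ℂ) * (Real.exp c : ℂ))⁻¹ = ((Real.exp (-c) / κ : ℝ) : ℂ) := by
      rw [Real.exp_neg]; push_cast; rw [one_mul, mul_inv, div_eq_mul_inv, mul_comm]
    rw [h3] at h2
    refine h2.congr' ?_
    filter_upwards [eventually_cobounded_one_lt_norm, hF.tendsto_cobounded.eventually
      eventually_cobounded_one_lt_norm] with z hz hFz
    have hFz0 : F z ≠ 0 := by rw [← norm_pos_iff]; linarith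
    have hA0 : A (F z) ≠ 0 := by
      simpa using hslit' (F z) (hF.2.1.mapsTo hz) 0 (by norm_num) (by norm_num)
    simp only [Function.comp_apply]
    field_simp
  have hgt : ∀ z : ℂ, 1 < ‖z‖ → 1 < ‖joukowskiInv (A (F z))‖ := fun z hz =>
    one_lt_norm_joukowskiInv (hslit' _ (hF.2.1.mapsTo hz))
  have hdiff : DifferentiableOn ℂ (fun z => z / joukowskiInv (A (F z))) {z | 1 < ‖z‖} := by
    intro z hz
    have hFd := hF.1.differentiableAt (isOpen_one_lt_norm.mem_nhds hz)
    have hAd : DifferentiableAt ℂ A (F z) :=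
      ((differentiableAt_id.add (differentiableAt_inv (hne0 _ (hF.2.1.mapsTo hz)))).sub_const
        _).mul_const _
    have hJd : DifferentiableAt ℂ (fun z => joukowskiInv (A (F z))) z :=
      (differentiableAt_joukowskiInv (hslit' _ (hF.2.1.mapsTo hz))).fun_comp' z (hAd.comp z hFd)
    exact (differentiableAt_id.div hJd
      (by rw [← norm_pos_iff]; linarith [hgt z hz])).differentiableWithinAt
  have h1 := (norm_le_one_of_exterior hdiff (fun ε hε => ⟨1 + ε, by linarith, fun z hz hzr => by
    rw [norm_div, div_le_iff₀ (by linarith [hgt z hz])]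
    nlinarith [hgt z hz]⟩) hlim).1
  rw [Complex.norm_real, Real.norm_of_nonneg (by positivity), div_le_one hκ0] at h1
  have h2 := Real.add_one_le_exp (-c)
  have h3 : (δ / (2 + δ)) ^ 2 = 1 - κ := by rw [hκ]; field_simp; ring
  linarith

open Filter Topology Bornology in
/-- An upper bound for the capacity of the union of the unit disc and points of a disc centred at
`a` that is orthogonal to the unit circle. -/
theorem exp_le_of_sq_le (hF : IsNormalizedExteriorMap K c F) {a : ℝ} (ha : 1 < a)
    (hball : Metric.closedBall 0 1 ⊆ K)
    (hK : ∀ w ∈ K, 1 < ‖w‖ → ‖w‖ ^ 2 + 1 ≤ 2 * a * w.re) : Real.exp c ≤ a := by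
  set H : ℂ → ℂ := fun w => w * (w - a) / (a * w - 1) with hH
  have ha0 : (a : ℂ) ≠ 0 := by exact_mod_cast (by linarith : a ≠ 0)
  have hden : ∀ w : ℂ, 1 ≤ ‖w‖ → (a : ℂ) * w - 1 ≠ 0 := by
    intro w hw h
    have h1 := congrArg norm (sub_eq_zero.1 h)
    rw [norm_mul, Complex.norm_real, Real.norm_of_nonneg (by linarith), norm_one] at h1
    nlinarith
  have hone : ∀ w ∉ K, 1 < ‖w‖ := fun w hw => by
    by_contra! h
    exact hw (hball (by simpa using h))
  have hHle : ∀ w ∈ K, 1 ≤ ‖w‖ → ‖H w‖ ≤ 1 := by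
    intro w hw hw1
    rw [hH, norm_div, div_le_one (norm_pos_iff.2 (hden w hw1)), ← sq_le_sq₀ (norm_nonneg _)
      (norm_nonneg _), norm_mul, mul_pow, ← Complex.normSq_eq_norm_sq,
      ← Complex.normSq_eq_norm_sq, ← Complex.normSq_eq_norm_sq]
    have h2 : (Complex.normSq w - 1) * (Complex.normSq w + 1 - 2 * a * w.re) ≤ 0 := by
      rcases hw1.eq_or_lt with h | h
      · simp [Complex.normSq_eq_norm_sq, ← h]
      · have := hK w hw h
        rw [Complex.normSq_eq_norm_sq]
        exact mul_nonpos_of_nonneg_of_nonpos (by nlinarith) (by linarith)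
    simp only [Complex.normSq_apply, Complex.sub_re, Complex.sub_im, Complex.ofReal_re,
      Complex.ofReal_im, Complex.re_ofReal_mul, Complex.im_ofReal_mul, Complex.one_re,
      Complex.one_im] at h2 ⊢
    linarith
  have hlim : Tendsto (fun z => H (F z) / z) (cobounded ℂ) (𝓝 ((Real.exp c / a : ℝ) : ℂ)) := by
    have hHdiv : Tendsto (fun w => H w / w) (cobounded ℂ) (𝓝 (1 / (a : ℂ))) := by
      have h0 := tendsto_inv₀_cobounded (α := ℂ)
      have h1 := ((h0.const_mul (a : ℂ)).const_sub 1).div (h0.const_sub (a : ℂ)) (by simpa using ha0)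
      simp only [mul_zero, sub_zero] at h1
      refine h1.congr' ?_
      filter_upwards [eventually_cobounded_one_lt_norm] with w hw
      have hw0 : w ≠ 0 := by rintro rfl; simp at hw; linarith
      have hd1 := hden w hw.le
      have hd2 : (a : ℂ) - w⁻¹ ≠ 0 := fun h => hd1 (by
        rw [sub_eq_zero.1 h, inv_mul_cancel₀ hw0, sub_self])
      simp only [hH, Pi.div_apply]
      rw [div_div, div_eq_div_iff hd2 (mul_ne_zero hd1 hw0)]
      field_simp
    have h1 := (hHdiv.comp hF.tendsto_cobounded).mul hF.tendsto_div
    rw [one_div, mul_comm, ← div_eq_mul_inv, ← Complex.ofReal_div] at h1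
    refine h1.congr' ?_
    filter_upwards [eventually_cobounded_one_lt_norm, hF.tendsto_cobounded.eventually
      eventually_cobounded_one_lt_norm] with z hz hFz
    have hFz0 : F z ≠ 0 := by rw [← norm_pos_iff]; linarith
    simp only [Function.comp_apply]
    field_simp
  have hdiff : DifferentiableOn ℂ (fun z => H (F z) / z) {z | 1 < ‖z‖} := by
    intro z hz
    have hz0 : z ≠ 0 := by rintro rfl; simp at hz; linarith
    have hd := hden (F z) (hone _ (hF.2.1.mapsTo hz)).le
    have hFd := hF.1.differentiableAt (isOpen_one_lt_norm.mem_nhds hz)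
    exact (((hFd.mul (hFd.sub_const _)).div ((hFd.const_mul _).sub_const _) hd).div
      differentiableAt_id hz0).differentiableWithinAt
  have h1 := (norm_le_one_of_exterior hdiff (fun ε hε => ?_) hlim).1
  · rwa [Complex.norm_real, Real.norm_of_nonneg (by positivity), div_le_one (by linarith)] at h1
  · obtain ⟨r, hr, h⟩ := hF.exists_forall_mem
      (V := {w : ℂ | ‖w * (w - a)‖ < (1 + ε) * ‖(a : ℂ) * w - 1‖})
      (isOpen_lt (by fun_prop) (by fun_prop)) (by
        rintro w ⟨hwK, hwc⟩
        have hw1 : 1 ≤ ‖w‖ := by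
          have : closure Kᶜ ⊆ {w : ℂ | 1 ≤ ‖w‖} :=
            closure_minimal (fun w hw => (hone w hw).le) (isClosed_le continuous_const
              continuous_norm)
          exact this hwc
        have h2 := hHle w hwK hw1
        have h3 := norm_pos_iff.2 (hden w hw1)
        rw [hH, norm_div, div_le_one h3] at h2
        show ‖w * (w - a)‖ < (1 + ε) * ‖(a : ℂ) * w - 1‖
        nlinarith)
    refine ⟨r, hr, fun z hz hzr => ?_⟩
    have h3 := norm_pos_iff.2 (hden (F z) (hone _ (hF.2.1.mapsTo hz)).le)
    have h2 : ‖F z * (F z - a)‖ < (1 + ε) * ‖(a : ℂ) * F z - 1‖ := h z hz hzr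
    rw [norm_div, norm_div, div_div, div_le_iff₀ (by positivity)]
    nlinarith [mul_pos h3 (by linarith : 0 < ‖z‖ - 1)]

end IsNormalizedExteriorMap

/-- For a connected particle `P ⊆ {|z-1| ≤ δ}` in the exterior of the unit disc,
symmetric under conjugation, with `1+δ ∈ P`, and `δ ∈ (0,1/3]`, the logarithmic capacity
`c = cap(K₀ ∪ P)` satisfies `δ²/6 ≤ c ≤ 3δ²/4`. -/
theorem stmt3 (δ : ℝ) (hδ : δ ∈ Set.Ioc (0:ℝ) (1/3)) (P : Set ℂ)
    (hPconn : IsConnected P)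
    (hPd : P ⊆ {z : ℂ | ‖z - 1‖ ≤ δ})
    (hPext : P ⊆ {z : ℂ | 1 < ‖z‖})
    (hPsymm : ∀ z ∈ P, (starRingEnd ℂ) z ∈ P)
    (hPone : ((1 + δ : ℝ) : ℂ) ∈ P)
    (c : ℝ) (F : ℂ → ℂ)
    (hF : IsNormalizedExteriorMap (Metric.closedBall (0:ℂ) 1 ∪ P) c F) :
    δ^2 / 6 ≤ c ∧ c ≤ 3 * δ^2 / 4 := by
  obtain ⟨hδ0, hδ1⟩ := hδ
  have hball := Set.subset_union_left (s := Metric.closedBall (0 : ℂ) 1) (t := P)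
  constructor
  · have hsymm : ∀ z ∈ Metric.closedBall (0 : ℂ) 1 ∪ P,
        (starRingEnd ℂ) z ∈ Metric.closedBall (0 : ℂ) 1 ∪ P := by
      rintro z (hz | hz)
      · exact Or.inl (by simpa using hz)
      · exact Or.inr (hPsymm z hz)
    have h1 := hF.le_of_slit_subset hδ0.le hball fun x hx1 hx2 =>
      hF.ofReal_mem_of_symm hsymm (a := 1) (b := 1 + δ) (Or.inl (by simp)) (Or.inr hPone)
        ⟨hx1, hx2⟩
    refine le_trans ?_ h1
    rw [div_pow]
    gcongr
    nlinarith
  · have h1 := hF.exp_le_of_sq_le (a := 1 + 3 * δ ^ 2 / 4) (by nlinarith) hball (by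
      intro w hw hw1
      rcases hw with hw | hw
      · exact absurd (mem_closedBall_zero_iff.1 hw) (not_le.2 hw1)
      have h2 : ‖w - 1‖ ≤ δ := hPd hw
      have hre : 2 / 3 ≤ w.re := by
        have h3 := (Complex.abs_re_le_norm (w - 1)).trans h2
        rw [Complex.sub_re, Complex.one_re] at h3
        linarith [(abs_le.1 h3).1]
      have h4 : ‖w - 1‖ ^ 2 ≤ δ ^ 2 := by gcongr
      rw [← Complex.normSq_eq_norm_sq, Complex.normSq_apply] at h4 ⊢
      simp only [Complex.sub_re, Complex.sub_im, Complex.one_re, Complex.one_im] at h4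
      nlinarith [mul_nonneg (sq_nonneg δ) (sub_nonneg.2 hre)])
    linarith [Real.add_one_le_exp c]
end

section
/- Let K be a compact connected set containing the closed unit disc K₀ with K∖K₀ ⊆ {z : |z-1| ≤ δ} and simply connected complement D. Then there is an absolute constant C such that the normalized conformal map G : D → D₀ satisfies |log(G(z)/z) + cap(K)| ≤ C·cap(K)/|z-1| for all z ∈ D with |z-1| > 2δ, where the branch of log(G(z)/z) is chosen continuous on D with limit -cap(K) at ∞. -/
section

open Complex Metric Set Filter Topology

/-- Maximum principle with a `limsup` condition at the boundary. -/
theorem norm_le_of_eventually_frontier {U : Set ℂ} (hUo : IsOpen U)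
    (hUb : Bornology.IsBounded U) {f : ℂ → ℂ} (hf : DifferentiableOn ℂ f U) {a : ℝ}
    (h : ∀ ξ ∈ frontier U, ∀ b > a, ∀ᶠ z in 𝓝[U] ξ, ‖f z‖ ≤ b) :
    ∀ z ∈ U, ‖f z‖ ≤ a := by
  intro z hz
  refine le_of_forall_gt_imp_ge_of_dense fun b hb => ?_
  by_contra! hzb
  have hWo : IsOpen {w | w ∈ U ∧ b < ‖f w‖} := by
    have := hf.continuousOn.norm.isOpen_inter_preimage hUo (isOpen_Ioi (a := b))
    exact this
  set W := {w | w ∈ U ∧ b < ‖f w‖} with hW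
  have hWU : W ⊆ U := fun w hw => hw.1
  have hcl : closure W ⊆ U := by
    intro ξ hξ
    by_contra hξU
    have hξf : ξ ∈ frontier U := by
      rw [frontier, hUo.interior_eq]
      exact ⟨closure_mono hWU hξ, hξU⟩
    have h1 : ∃ᶠ w in 𝓝 ξ, w ∈ W := mem_closure_iff_frequently.1 hξ
    have h2 := eventually_nhdsWithin_iff.1 (h ξ hξf b hb)
    obtain ⟨w, hw1, hw2⟩ := (h1.and_eventually h2).exists
    exact absurd (hw2 hw1.1) (not_le.2 hw1.2)
  have hd : DiffContOnCl ℂ f W := ⟨hf.mono hWU, hf.continuousOn.mono hcl⟩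
  have := norm_le_of_forall_mem_frontier_norm_le (hUb.subset hWU) hd (C := b)
    (fun w hw => by
      rw [frontier, hWo.interior_eq] at hw
      by_contra! hc
      exact hw.2 ⟨hcl hw.1, hc⟩) (subset_closure (show z ∈ W from ⟨hz, hzb⟩))
  linarith

/-- Maximum principle for the real part of a holomorphic function. -/
theorem re_le_of_eventually_frontier {U : Set ℂ} (hUo : IsOpen U)
    (hUb : Bornology.IsBounded U) {f : ℂ → ℂ} (hf : DifferentiableOn ℂ f U) {a : ℝ}
    (h : ∀ ξ ∈ frontier U, ∀ b > a, ∀ᶠ z in 𝓝[U] ξ, (f z).re ≤ b) :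
    ∀ z ∈ U, (f z).re ≤ a := by
  intro z hz
  have := norm_le_of_eventually_frontier (f := fun z => exp (f z)) hUo hUb hf.cexp
    (a := Real.exp a) (fun ξ hξ b hb => by
      have hb0 : 0 < b := (Real.exp_pos a).trans hb
      filter_upwards [h ξ hξ (Real.log b) ((Real.lt_log_iff_exp_lt hb0).2 hb)] with w hw
      rw [norm_exp, ← Real.le_log_iff_exp_le hb0]
      exact hw) z hz
  rwa [norm_exp, Real.exp_le_exp] at this

/-- A continuous real function on the unit circle is uniformly approximated by real parts of
entire functions. -/
theorem exists_entire_re_near {V : ℂ → ℝ} (hV : ContinuousOn V (sphere 0 1)) {ε : ℝ}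
    (hε : 0 < ε) :
    ∃ p : ℂ → ℂ, Differentiable ℂ p ∧ ∀ ξ ∈ sphere (0 : ℂ) 1, |(p ξ).re - V ξ| ≤ ε := by
  have : Fact (0 < 2 * Real.pi) := ⟨by positivity⟩
  have hsph (x : AddCircle (2 * Real.pi)) : (AddCircle.toCircle x : ℂ) ∈ sphere (0 : ℂ) 1 := by
    rw [mem_sphere_zero_iff_norm, Circle.norm_coe]
  let g : C(AddCircle (2 * Real.pi), ℂ) :=
    ⟨fun x => ((V (AddCircle.toCircle x) : ℝ) : ℂ), by
      refine continuous_ofReal.comp (hV.comp_continuous ?_ hsph)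
      exact continuous_subtype_val.comp AddCircle.continuous_toCircle⟩
  have key : ∀ q ∈ Submodule.span ℂ (range (@fourier (2 * Real.pi))),
      ∃ p₁ p₂ : ℂ → ℂ, Differentiable ℂ p₁ ∧ Differentiable ℂ p₂ ∧
        ∀ x, q x = p₁ (AddCircle.toCircle x) + (starRingEnd ℂ) (p₂ (AddCircle.toCircle x)) := by
    intro q hq
    induction hq using Submodule.span_induction with
    | mem q hq =>
      obtain ⟨n, rfl⟩ := hq
      obtain ⟨m, rfl | rfl⟩ := n.eq_nat_or_neg
      · refine ⟨fun z => z ^ m, fun _ => 0, by fun_prop, by fun_prop, fun x => ?_⟩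
        simp [fourier_apply, AddCircle.toCircle_nsmul]
      · refine ⟨fun _ => 0, fun z => z ^ m, by fun_prop, by fun_prop, fun x => ?_⟩
        simp [fourier_apply, AddCircle.toCircle_neg, AddCircle.toCircle_nsmul]
        rw [← inv_pow, ← Circle.coe_inv, Circle.coe_inv_eq_conj]
    | zero => exact ⟨fun _ => 0, fun _ => 0, by fun_prop, by fun_prop, fun x => by simp⟩
    | add q r _ _ hq hr =>
      obtain ⟨p₁, p₂, h₁, h₂, h⟩ := hq
      obtain ⟨r₁, r₂, k₁, k₂, k⟩ := hr
      refine ⟨fun z => p₁ z + r₁ z, fun z => p₂ z + r₂ z, by fun_prop, by fun_prop,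
        fun x => ?_⟩
      simp only [ContinuousMap.add_apply, h, k, map_add]
      ring
    | smul c q _ hq =>
      obtain ⟨p₁, p₂, h₁, h₂, h⟩ := hq
      refine ⟨fun z => c * p₁ z, fun z => (starRingEnd ℂ) c * p₂ z, by fun_prop, by fun_prop,
        fun x => ?_⟩
      simp only [ContinuousMap.smul_apply, h, map_mul, smul_eq_mul, conj_conj]
      ring
  have hg : g ∈ (Submodule.span ℂ (range (@fourier (2 * Real.pi)))).topologicalClosure := by
    rw [span_fourier_closure_eq_top]; trivial
  obtain ⟨q, hq, hqg⟩ := Metric.mem_closure_iff.1 hg ε hε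
  obtain ⟨p₁, p₂, h₁, h₂, h⟩ := key q hq
  refine ⟨fun z => p₁ z + p₂ z, by fun_prop, fun ξ hξ => ?_⟩
  obtain ⟨x, hx⟩ := (AddCircle.homeomorphCircle (T := 2 * Real.pi) (by positivity)).surjective
    (⟨ξ, by simpa [Submonoid.unitSphere] using hξ⟩ : Circle)
  have hx' : (AddCircle.toCircle x : ℂ) = ξ := by
    have := congrArg (fun z : Circle => (z : ℂ)) hx
    simpa [AddCircle.homeomorphCircle_apply] using this
  have h3 : ‖g x - q x‖ < ε := by
    rw [← dist_eq_norm]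
    exact (ContinuousMap.dist_apply_le_dist x).trans_lt hqg
  rw [h x, hx'] at h3
  have h4 := (abs_re_le_norm _).trans h3.le
  have h5 : (g x).re = V ξ := by simp [g, hx']
  rw [sub_re, h5, add_re, conj_re] at h4
  rw [abs_sub_comm, add_re]
  exact h4

/-- Gradient estimate for a holomorphic function with nonnegative real part. -/
theorem norm_deriv_le_of_re_nonneg {φ : ℂ → ℂ} {s : ℂ} {r : ℝ} (hr : 0 < r)
    (hφ : DifferentiableOn ℂ φ (ball s r)) (hp : ∀ z ∈ ball s r, 0 ≤ (φ z).re) :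
    ‖deriv φ s‖ ≤ 4 * (φ s).re / r := by
  refine le_of_forall_gt_imp_ge_of_dense fun b hb => ?_
  set M := b * r / 4 with hM
  have hMφ : (φ s).re < M := by
    rw [div_lt_iff₀ hr] at hb
    linarith
  have hs0 := hp s (mem_ball_self hr)
  have hmaps : MapsTo (fun w => s + w) (ball 0 r) (ball s r) := by
    intro w hw; simpa [dist_eq_norm] using hw
  have hsub : ball s (r / 2) ⊆ ball s r := ball_subset_ball (by linarith)
  have h1 : ∀ z ∈ sphere s (r / 2), ‖φ z - φ s‖ ≤ 2 * M := by
    intro z hz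
    have hz' : ‖z - s‖ = r / 2 := by simpa [dist_eq_norm] using hz
    have := borelCaratheodory_zero (f := fun w => φ s - φ (s + w)) (M := M) (R := r)
      (z := z - s) (by linarith)
      ((differentiableOn_const _).sub (hφ.comp (by fun_prop) hmaps))
      (fun w hw => by
        have := hp _ (hmaps hw)
        simp only [mem_ofPred_eq, sub_re]; linarith) hr
      (by rw [mem_ball_zero_iff, hz']; linarith) (by simp)
    rw [hz', add_sub_cancel, norm_sub_rev] at this
    refine this.trans (le_of_eq ?_)
    field_simp; ring
  have hd : DiffContOnCl ℂ (fun z => φ z - φ s) (ball s (r / 2)) := by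
    refine DifferentiableOn.diffContOnCl ?_
    refine (hφ.sub_const _).mono ?_
    rw [closure_ball _ (by positivity)]
    exact closedBall_subset_ball (by linarith)
  have h2 := norm_deriv_le_of_forall_mem_sphere_norm_le (by positivity) hd h1
  rw [deriv_sub_const_fun] at h2
  refine h2.trans (le_of_eq ?_)
  rw [hM]; field_simp; ring

/-- Maximum principle on the unit disc: a lower bound on the real part propagates from the
circle to the closed disc. -/
theorem re_ge_of_sphere {k : ℂ → ℂ} (hk : Differentiable ℂ k) {b : ℝ}
    (h : ∀ ξ ∈ sphere (0 : ℂ) 1, b ≤ (k ξ).re) : ∀ z ∈ ball (0 : ℂ) 1, b ≤ (k z).re := by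
  intro z hz
  have := re_le_of_eventually_frontier (U := ball (0 : ℂ) 1) isOpen_ball isBounded_ball
    (f := fun z => -k z) (by fun_prop) (a := -b) (fun ξ hξ c hc => by
      rw [frontier_ball _ one_ne_zero] at hξ
      have hcont : Continuous fun z => (-k z).re :=
        continuous_re.comp hk.continuous.neg
      have hlt : (-k ξ).re < c := by
        have := h ξ hξ
        rw [neg_re]; linarith
      exact (((hcont.tendsto ξ).eventually_lt_const hlt).mono fun _ h => h.le).filter_mono
        nhdsWithin_le_nhds) z hz
  rw [neg_re] at this
  linarith

/-- Growth estimate in a half disc for an entire function whose real part vanishes on the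
imaginary axis and has almost the sign of `re` on the unit circle. -/
theorem re_le_of_almost_typically_real {P : ℂ → ℂ} (hP : Differentiable ℂ P)
    (hP0 : ∀ ξ : ℂ, ξ.re = 0 → (P ξ).re = 0) {η : ℝ} (hη : 0 < η)
    (hpos : ∀ ξ ∈ sphere (0 : ℂ) 1, 0 ≤ ξ.re → -η ≤ (P ξ).re)
    (hneg : ∀ ξ ∈ sphere (0 : ℂ) 1, ξ.re ≤ 0 → (P ξ).re ≤ η)
    {s₀ : ℝ} (hs₀ : 0 < s₀) (hs₀' : s₀ ≤ 2 / 9) {s : ℂ} (hs : ‖s‖ ≤ 8 / 9) (hsr : 0 ≤ s.re) :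
    (P s).re ≤ 31920 * ((P s₀).re / s₀ + 5 * η) * s.re := by
  set k : ℂ → ℂ := fun z => (1 + z ^ 2) * dslope P 0 z with hkdef
  have hds : Differentiable ℂ (dslope P 0) := by
    rw [← differentiableOn_univ]
    exact (differentiableOn_dslope univ_mem).2 hP.differentiableOn
  have hk : Differentiable ℂ k := by fun_prop
  have hPk (z : ℂ) : (1 + z ^ 2) * (P z - P 0) = z * k z := by
    have := sub_smul_dslope P 0 z
    simp only [sub_zero, smul_eq_mul] at this
    rw [hkdef, ← this]; ring
  have hP00 : (P 0).re = 0 := hP0 0 rfl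
  have hk0im : (k 0).im = 0 := by
    have h1 : HasDerivAt (fun y : ℝ => P (y * I)) (deriv P 0 * I) 0 := by
      have h2 : HasDerivAt (fun y : ℝ => (y : ℂ) * I) I 0 := by
        simpa using (HasDerivAt.ofReal_comp (hasDerivAt_id (0 : ℝ))).mul_const I
      have h3 : HasDerivAt P (deriv P 0) (((0 : ℝ) : ℂ) * I) := by
        simpa using (hP 0).hasDerivAt
      exact h3.comp (0 : ℝ) h2
    have h4 : HasDerivAt (fun y : ℝ => (P (y * I)).re) (deriv P 0 * I).re 0 :=
      reCLM.hasFDerivAt.comp_hasDerivAt (0 : ℝ) h1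
    have h5 : (fun y : ℝ => (P (y * I)).re) = fun _ => 0 := by
      funext y; exact hP0 _ (by simp)
    rw [h5] at h4
    have := h4.unique (hasDerivAt_const _ _)
    simpa [hkdef, dslope_same] using this
  have hkcirc : ∀ ξ ∈ sphere (0 : ℂ) 1, -(2 * η) ≤ (k ξ).re := by
    intro ξ hξ
    have hn : ‖ξ‖ = 1 := by simpa using hξ
    have hre : |ξ.re| ≤ 1 := hn ▸ abs_re_le_norm ξ
    have hξ0 : ξ ≠ 0 := by rw [← norm_pos_iff, hn]; exact one_pos
    have hconj : ξ * (starRingEnd ℂ) ξ = 1 := by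
      rw [mul_conj, normSq_eq_norm_sq, hn]; simp
    have h1 : k ξ = (2 * ξ.re : ℝ) * (P ξ - P 0) := by
      apply mul_left_cancel₀ hξ0
      rw [← hPk, ← add_conj ξ]
      linear_combination (-(P ξ - P 0)) * hconj
    rw [h1, re_ofReal_mul, sub_re, hP00, sub_zero]
    rw [abs_le] at hre
    rcases le_total 0 ξ.re with h0 | h0
    · nlinarith [hpos ξ hξ h0]
    · nlinarith [hneg ξ hξ h0]
  have hkdisc := re_ge_of_sphere hk hkcirc
  set a : ℝ := (k 0).re + 3 * η with ha
  have haη : η ≤ a := by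
    have := hkdisc 0 (mem_ball_self one_pos)
    linarith
  have ha0 : 0 < a := hη.trans_le haη
  have hka : ∀ z ∈ ball (0 : ℂ) 1, ‖k 0 - k z‖ ≤ 2 * a * ‖z‖ / (1 - ‖z‖) := by
    intro z hz
    refine borelCaratheodory_zero (f := fun z => k 0 - k z) ha0 (by fun_prop) (fun w hw => ?_)
      one_pos hz (by simp)
    have := hkdisc w hw
    simp only [mem_ofPred_eq, sub_re]; linarith
  set X : ℝ := (P s₀).re / s₀ with hX
  have hXk : (1 + s₀ ^ 2) * X = (k s₀).re := by
    have h1 := congrArg re (hPk s₀)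
    have h2 : (1 + (s₀ : ℂ) ^ 2) = ((1 + s₀ ^ 2 : ℝ) : ℂ) := by push_cast; ring
    rw [h2, re_ofReal_mul, re_ofReal_mul, sub_re, hP00, sub_zero] at h1
    rw [hX]; field_simp; linarith
  have hs₀n : ‖(s₀ : ℂ)‖ = s₀ := by rw [norm_real, Real.norm_of_nonneg hs₀.le]
  have haX : a ≤ 14 / 3 * X + 21 * η := by
    have h1 := hka s₀ (by rw [mem_ball_zero_iff, hs₀n]; linarith)
    rw [hs₀n] at h1
    have h2 : 2 * a * s₀ / (1 - s₀) ≤ 4 / 7 * a := by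
      rw [div_le_iff₀ (by linarith)]; nlinarith
    have h3 := (le_abs_self _).trans ((abs_re_le_norm _).trans (h1.trans h2))
    rw [sub_re, ← hXk] at h3
    have h4 : -(3 * η) ≤ X := by
      by_contra! h
      nlinarith [sq_nonneg s₀]
    have h5 : 0 ≤ (X + 3 * η) * (1 - s₀ ^ 2) :=
      mul_nonneg (by linarith) (by nlinarith)
    nlinarith [mul_nonneg hη.le (sq_nonneg s₀)]
  have hPb : ∀ z : ℂ, ‖z‖ ≤ 17 / 18 → ‖P z - P 0‖ ≤ 380 * a := by
    intro z hz
    have h1 := hka z (by rw [mem_ball_zero_iff]; linarith)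
    have h2 : 2 * a * ‖z‖ / (1 - ‖z‖) ≤ 34 * a := by
      rw [div_le_iff₀ (by linarith)]; nlinarith
    have h3 : ‖k 0‖ ≤ 4 * a := by
      have h4 : k 0 = ((k 0).re : ℂ) := by
        apply Complex.ext <;> simp [hk0im]
      rw [h4, norm_real, Real.norm_eq_abs, abs_le]
      constructor <;> linarith
    have h5 : ‖k z‖ ≤ 38 * a := by
      have := norm_sub_norm_le (k z) (k 0)
      rw [norm_sub_rev] at this
      linarith
    have h6 : 35 / 324 ≤ ‖1 + z ^ 2‖ := by
      have := norm_sub_norm_le (1 : ℂ) (-z ^ 2)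
      rw [norm_neg, norm_pow, norm_one, sub_neg_eq_add] at this
      nlinarith [norm_nonneg z]
    have h7 := congrArg norm (hPk z)
    rw [norm_mul, norm_mul] at h7
    nlinarith [norm_nonneg z, norm_nonneg (k z), norm_nonneg (P z - P 0)]
  have hPd : ∀ z ∈ closedBall (0 : ℂ) (8 / 9), ‖deriv P z‖ ≤ 6840 * a := by
    intro z hz
    rw [mem_closedBall_zero_iff] at hz
    have := norm_deriv_le_of_forall_mem_sphere_norm_le (f := fun w => P w - P 0) (c := z)
      (R := 1 / 18) (C := 380 * a) (by norm_num) (hP.sub_const _).diffContOnCl (fun w hw => by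
        apply hPb
        have h1 : ‖w - z‖ = 1 / 18 := by simpa [dist_eq_norm] using hw
        have := norm_add_le (w - z) z
        rw [sub_add_cancel] at this
        linarith)
    rw [deriv_sub_const_fun] at this
    linarith
  have him : ‖(s.im * I : ℂ)‖ ≤ 8 / 9 := by
    rw [norm_mul, norm_I, mul_one, norm_real]
    exact (abs_im_le_norm s).trans hs
  have hmv := (convex_closedBall (0 : ℂ) (8 / 9)).norm_image_sub_le_of_norm_deriv_le
    (fun z _ => hP z) hPd (x := s.im * I) (y := s) (by simpa using him) (by simpa using hs)
  have hsub : s - s.im * I = (s.re : ℂ) := by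
    apply Complex.ext <;> simp
  rw [hsub, norm_real, Real.norm_of_nonneg hsr] at hmv
  have := (le_abs_self _).trans ((abs_re_le_norm _).trans hmv)
  rw [sub_re, hP0 (s.im * I) (by simp), sub_zero] at this
  exact this.trans (mul_le_mul_of_nonneg_right (by linarith) hsr)

/-- Boundary Harnack estimate in a half disc: a nonnegative real part of a holomorphic function
which vanishes on the diameter grows at most linearly, at the rate seen at a point of the
axis. -/
theorem re_le_of_vanishing_on_diameter {R : ℝ} (hR : 1 < R) {φ : ℂ → ℂ}
    (hφ : DifferentiableOn ℂ φ {s | 0 < s.re ∧ ‖s‖ < R})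
    (hpos : ∀ s : ℂ, 0 < s.re → ‖s‖ < R → 0 ≤ (φ s).re)
    (hcont : ContinuousOn (fun s : ℂ => if 0 < s.re then (φ s).re else 0) (ball 0 R))
    {s₀ : ℝ} (hs₀ : 0 < s₀) (hs₀' : s₀ ≤ 2 / 9) {s : ℂ} (hs : ‖s‖ ≤ 8 / 9) (hsr : 0 < s.re) :
    (φ s).re ≤ 31920 * ((φ s₀).re / s₀) * s.re := by
  set V : ℂ → ℝ := fun s => if 0 < s.re then (φ s).re else 0 with hV
  have hVpos {z : ℂ} (h : 0 < z.re) : V z = (φ z).re := if_pos h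
  have hVneg {z : ℂ} (h : z.re ≤ 0) : V z = 0 := if_neg h.not_gt
  have hVnn {z : ℂ} (h : ‖z‖ = 1) : 0 ≤ V z := by
    rcases lt_or_ge 0 z.re with h0 | h0
    · rw [hVpos h0]; exact hpos z h0 (h ▸ hR)
    · rw [hVneg h0]
  have key : ∀ ε > 0, (φ s).re ≤
      31920 * (((φ s₀).re + 2 * ε) / s₀ + 5 * (2 * ε)) * s.re + 2 * ε := by
    intro ε hε
    obtain ⟨p, hp, hpV⟩ := exists_entire_re_near (hcont.mono
      ((sphere_subset_closedBall).trans (closedBall_subset_ball hR))) hε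
    set P : ℂ → ℂ := fun z => p z - (starRingEnd ℂ) (p (-(starRingEnd ℂ) z)) with hPdef
    have hP : Differentiable ℂ P := by
      refine hp.sub ?_
      intro z
      have hd : Differentiable ℂ fun w => p (-w) := by fun_prop
      have := (hd ((starRingEnd ℂ) z)).conj_conj
      simpa [Function.comp_def] using this
    have hPre (z : ℂ) : (P z).re = (p z).re - (p (-(starRingEnd ℂ) z)).re := by
      simp [hPdef]
    have hP0 (z : ℂ) (hz : z.re = 0) : (P z).re = 0 := by
      have : -(starRingEnd ℂ) z = z := by
        apply Complex.ext <;> simp [hz]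
      rw [hPre, this, sub_self]
    have hcirc (z : ℂ) (hz : ‖z‖ = 1) : |(P z).re - (V z - V (-(starRingEnd ℂ) z))| ≤ 2 * ε := by
      have h1 := hpV z (by simpa using hz)
      have h2 := hpV (-(starRingEnd ℂ) z) (by simpa using hz)
      rw [hPre]
      rw [abs_le] at h1 h2 ⊢
      constructor <;> linarith [h1.1, h1.2, h2.1, h2.2]
    have hclose : ∀ z : ℂ, 0 < z.re → ‖z‖ < 1 → |(φ z).re - (P z).re| ≤ 2 * ε := by
      set U : Set ℂ := {z | 0 < z.re ∧ ‖z‖ < 1} with hU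
      have hUo : IsOpen U :=
        (isOpen_lt continuous_const continuous_re).inter (isOpen_lt continuous_norm continuous_const)
      have hUb : Bornology.IsBounded U :=
        isBounded_ball.subset (fun z hz => mem_ball_zero_iff.2 hz.2 : U ⊆ ball (0 : ℂ) 1)
      have hφU : DifferentiableOn ℂ φ U := hφ.mono fun z hz => ⟨hz.1, hz.2.trans hR⟩
      have hbd : ∀ ξ ∈ frontier U, ξ ∈ ball (0 : ℂ) R ∧ |V ξ - (P ξ).re| ≤ 2 * ε := by
        intro ξ hξ
        have hcl : 0 ≤ ξ.re ∧ ‖ξ‖ ≤ 1 := by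
          have hclosed : IsClosed {z : ℂ | 0 ≤ z.re ∧ ‖z‖ ≤ 1} :=
            (isClosed_le continuous_const continuous_re).inter
              (isClosed_le continuous_norm continuous_const)
          have hsub : U ⊆ {z : ℂ | 0 ≤ z.re ∧ ‖z‖ ≤ 1} := fun z hz => ⟨hz.1.le, hz.2.le⟩
          exact closure_minimal hsub hclosed (frontier_subset_closure hξ)
        have hnot : ¬(0 < ξ.re ∧ ‖ξ‖ < 1) := by
          rw [frontier, hUo.interior_eq] at hξ
          exact hξ.2
        refine ⟨mem_ball_zero_iff.2 (hcl.2.trans_lt hR), ?_⟩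
        rcases hcl.1.eq_or_lt with h0 | h0
        · rw [hVneg h0.ge, hP0 ξ h0.symm]; simpa using hε.le
        · have h1 : ‖ξ‖ = 1 := le_antisymm hcl.2 (not_lt.1 fun h => hnot ⟨h0, h⟩)
          have h2 := hcirc ξ h1
          have h3 : V (-(starRingEnd ℂ) ξ) = 0 := hVneg (by simpa using h0.le)
          rwa [h3, sub_zero, abs_sub_comm] at h2
      have hev : ∀ ξ ∈ frontier U, ∀ b > 2 * ε, ∀ᶠ z in 𝓝[U] ξ,
          |(φ z).re - (P z).re| ≤ b := by
        intro ξ hξ b hb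
        obtain ⟨hξR, hξb⟩ := hbd ξ hξ
        have hc : ContinuousAt (fun z => |V z - (P z).re|) ξ :=
          ((hcont.continuousAt (isOpen_ball.mem_nhds hξR)).sub
            (continuous_re.comp hP.continuous).continuousAt).abs
        have h1 := (hc.eventually_lt_const (hξb.trans_lt hb)).filter_mono
          (nhdsWithin_le_nhds (s := U))
        filter_upwards [h1, self_mem_nhdsWithin] with z hz hzU
        rw [hVpos hzU.1] at hz
        exact hz.le
      intro z hz0 hz1
      rw [abs_le]
      have h1 := re_le_of_eventually_frontier hUo hUb (f := fun z => φ z - P z)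
        (hφU.sub hP.differentiableOn) (a := 2 * ε) (fun ξ hξ b hb =>
          (hev ξ hξ b hb).mono fun z hz => by rw [sub_re]; exact (abs_le.1 hz).2) z (show z ∈ U from ⟨hz0, hz1⟩)
      have h2 := re_le_of_eventually_frontier hUo hUb (f := fun z => P z - φ z)
        (hP.differentiableOn.sub hφU) (a := 2 * ε) (fun ξ hξ b hb =>
          (hev ξ hξ b hb).mono fun z hz => by
            rw [sub_re]; linarith [(abs_le.1 hz).1]) z (show z ∈ U from ⟨hz0, hz1⟩)
      rw [sub_re] at h1 h2
      constructor <;> linarith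
    have hest := re_le_of_almost_typically_real hP hP0 (η := 2 * ε) (by positivity)
      (fun ξ hξ h0 => by
        have hn : ‖ξ‖ = 1 := by simpa using hξ
        have h1 := (abs_le.1 (hcirc ξ hn)).1
        have h2 : V (-(starRingEnd ℂ) ξ) = 0 := hVneg (by simpa using h0)
        have h3 := hVnn hn
        linarith)
      (fun ξ hξ h0 => by
        have hn : ‖ξ‖ = 1 := by simpa using hξ
        have h1 := (abs_le.1 (hcirc ξ hn)).2
        have h2 : V ξ = 0 := hVneg h0
        have h3 := hVnn (z := -(starRingEnd ℂ) ξ) (by simpa using hn)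
        linarith) hs₀ hs₀' hs hsr.le
    have h1 := (abs_le.1 (hclose s hsr (by linarith))).2
    have h2 := (abs_le.1 (hclose s₀ (by simpa using hs₀)
      (by rw [norm_real, Real.norm_of_nonneg hs₀.le]; linarith))).1
    calc (φ s).re ≤ (P s).re + 2 * ε := by linarith
      _ ≤ 31920 * ((P s₀).re / s₀ + 5 * (2 * ε)) * s.re + 2 * ε := by gcongr
      _ ≤ _ := by gcongr; linarith
  have hlim : Tendsto (fun ε : ℝ => 31920 * (((φ s₀).re + 2 * ε) / s₀ + 5 * (2 * ε)) * s.re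
      + 2 * ε) (𝓝[>] 0) (𝓝 (31920 * ((φ s₀).re / s₀) * s.re)) := by
    refine Tendsto.mono_left ?_ nhdsWithin_le_nhds
    have : Continuous fun ε : ℝ => 31920 * (((φ s₀).re + 2 * ε) / s₀ + 5 * (2 * ε)) * s.re
      + 2 * ε := by fun_prop
    simpa using this.tendsto 0
  exact ge_of_tendsto hlim (eventually_mem_nhdsWithin.mono fun ε hε => key ε hε)

/-- Lipschitz estimate up to the diameter for a holomorphic function in a half disc whose real
part is nonnegative and vanishes on the diameter. -/
theorem norm_sub_le_of_vanishing_on_diameter {R : ℝ} (hR : 1 < R) {φ : ℂ → ℂ}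
    (hφ : DifferentiableOn ℂ φ {s | 0 < s.re ∧ ‖s‖ < R})
    (hpos : ∀ s : ℂ, 0 < s.re → ‖s‖ < R → 0 ≤ (φ s).re)
    (hcont : ContinuousOn (fun s : ℂ => if 0 < s.re then (φ s).re else 0) (ball 0 R))
    {s₀ : ℝ} (hs₀ : 0 < s₀) (hs₀' : s₀ ≤ 2 / 9) {s : ℂ} (hs : ‖s‖ ≤ 8 / 9) (hsr : 0 < s.re) :
    ‖φ s - φ s₀‖ ≤ 2298240 * ((φ s₀).re / s₀) * ‖s - s₀‖ := by
  have hopen : IsOpen {s : ℂ | 0 < s.re ∧ ‖s‖ < R} :=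
    (isOpen_lt continuous_const continuous_re).inter (isOpen_lt continuous_norm continuous_const)
  have hconv : Convex ℝ {s : ℂ | 0 < s.re ∧ ‖s‖ ≤ 8 / 9} := by
    have h1 : Convex ℝ {s : ℂ | 0 < s.re} := convex_halfSpace_re_gt 0
    have h2 := convex_closedBall (0 : ℂ) (8 / 9)
    convert! h1.inter h2 using 1
    ext z; simp
  refine hconv.norm_image_sub_le_of_norm_deriv_le (𝕜 := ℂ) (fun z hz => ?_) (fun z hz => ?_)
    ⟨by simpa using hs₀, by rw [norm_real, Real.norm_of_nonneg hs₀.le]; linarith⟩ ⟨hsr, hs⟩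
  · exact (hφ z ⟨hz.1, by linarith [hz.2]⟩).differentiableAt
      (hopen.mem_nhds ⟨hz.1, by linarith [hz.2]⟩)
  · obtain ⟨hz0, hz1⟩ := hz
    have hzn : z.re ≤ 8 / 9 := (re_le_norm z).trans hz1
    have hball : ball z (z.re / 18) ⊆ {s : ℂ | 0 < s.re ∧ ‖s‖ < R} := by
      intro w hw
      have h1 : ‖w - z‖ < z.re / 18 := by simpa [dist_eq_norm] using hw
      have h2 := (abs_le.1 ((abs_re_le_norm _).trans h1.le)).1
      have h3 := norm_add_le (w - z) z
      rw [sub_add_cancel] at h3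
      rw [sub_re] at h2
      exact ⟨by linarith, by linarith⟩
    have h1 := norm_deriv_le_of_re_nonneg (by positivity) (hφ.mono hball)
      fun w hw => hpos w (hball hw).1 (hball hw).2
    have h2 := re_le_of_vanishing_on_diameter hR hφ hpos hcont hs₀ hs₀' hz1 hz0
    refine h1.trans ?_
    rw [div_le_iff₀ (by positivity)]
    nlinarith

/-- An injective holomorphic map onto the exterior of the unit disc which has linear growth sends
boundary points to the unit circle. -/
theorem eventually_norm_le_of_bijOn_exterior {K : Set ℂ} (hK : IsClosed K) {G : ℂ → ℂ}
    (hG : DifferentiableOn ℂ G Kᶜ) (hbij : BijOn G Kᶜ {z : ℂ | 1 < ‖z‖}) {α : ℂ} {M : ℝ}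
    (hM : ∀ z ∈ Kᶜ, ‖G z - α * z‖ ≤ M) {z₀ : ℂ} (hz₀ : z₀ ∈ K) {b : ℝ} (hb : 1 < b) :
    ∀ᶠ z in 𝓝[Kᶜ] z₀, ‖G z‖ ≤ b := by
  by_contra hcon
  rw [not_eventually] at hcon
  set B : ℝ := M + ‖α‖ * (‖z₀‖ + 1) with hB
  have hA : IsCompact {w : ℂ | b ≤ ‖w‖ ∧ ‖w‖ ≤ B} := by
    refine (isCompact_closedBall (0 : ℂ) B).of_isClosed_subset
      ((isClosed_le continuous_const continuous_norm).inter
        (isClosed_le continuous_norm continuous_const)) fun w hw => ?_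
    simpa using hw.2
  have hev : ∀ᶠ z in 𝓝[Kᶜ] z₀, ‖G z‖ ≤ B := by
    have h1 : ∀ᶠ z in 𝓝[Kᶜ] z₀, ‖z‖ < ‖z₀‖ + 1 :=
      ((continuous_norm.tendsto z₀).eventually_lt_const (lt_add_one _)).filter_mono
        nhdsWithin_le_nhds
    filter_upwards [h1, self_mem_nhdsWithin] with z hz hzK
    have h2 := norm_add_le (G z - α * z) (α * z)
    rw [sub_add_cancel, norm_mul] at h2
    have h3 := hM z hzK
    have h4 := mul_le_mul_of_nonneg_left hz.le (norm_nonneg α)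
    rw [hB]; linarith
  have hfr : ∃ᶠ z in 𝓝[Kᶜ] z₀, G z ∈ {w : ℂ | b ≤ ‖w‖ ∧ ‖w‖ ≤ B} :=
    (hcon.and_eventually hev).mono fun z hz => ⟨(not_le.1 hz.1).le, hz.2⟩
  obtain ⟨w, hw, hcl⟩ := hA.exists_mapClusterPt_of_frequently hfr
  obtain ⟨y, hy, rfl⟩ := hbij.surjOn (show w ∈ {z : ℂ | 1 < ‖z‖} from hb.trans_le hw.1)
  have hyz : y ≠ z₀ := fun h => hy (h ▸ hz₀)
  obtain ⟨N, N', hN, hN', hyN, hzN', hdisj⟩ := t2_separation hyz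
  have hopen : 𝓝 (G y) ≤ map G (𝓝 y) := by
    refine ((hG.analyticAt (hK.isOpen_compl.mem_nhds hy)).eventually_constant_or_nhds_le_map_nhds
      ).resolve_left fun hc => ?_
    have h1 : ∀ᶠ z in 𝓝 y, z = y := by
      filter_upwards [hc, hK.isOpen_compl.mem_nhds hy] with z hz hzK
      exact hbij.injOn hzK hy hz
    have h2 : ({y} : Set ℂ) ∈ 𝓝 y := h1
    exact not_isOpen_singleton y (isOpen_singleton_iff_nhds_eq_pure y |>.2
      (le_antisymm (le_pure_iff.2 h2) (pure_le_nhds y)))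
  have himg : G '' (N ∩ Kᶜ) ∈ 𝓝 (G y) := by
    apply hopen
    exact image_mem_map (inter_mem (hN.mem_nhds hyN) (hK.isOpen_compl.mem_nhds hy))
  have h1 : ∃ᶠ z in 𝓝[Kᶜ] z₀, G z ∈ G '' (N ∩ Kᶜ) := hcl.frequently himg
  have h2 : ∀ᶠ z in 𝓝[Kᶜ] z₀, z ∈ N' ∩ Kᶜ :=
    inter_mem (mem_nhdsWithin_of_mem_nhds (hN'.mem_nhds hzN')) self_mem_nhdsWithin
  obtain ⟨z, ⟨x, hx, hxz⟩, hz⟩ := (h1.and_eventually h2).exists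
  have := hbij.injOn hx.2 hz.2 hxz
  exact disjoint_left.1 hdisj hx.1 (this ▸ hz.1)

/-- The normalized conformal map onto the exterior of the unit disc does not increase the
modulus, and its derivative at infinity has modulus at most one. -/
theorem norm_le_of_bijOn_exterior {K : Set ℂ} (hK : IsCompact K)
    (hKD : closedBall (0 : ℂ) 1 ⊆ K) {G : ℂ → ℂ} (hG : DifferentiableOn ℂ G Kᶜ)
    (hbij : BijOn G Kᶜ {z : ℂ | 1 < ‖z‖}) {α : ℂ} {M : ℝ}
    (hM : ∀ z ∈ Kᶜ, ‖G z - α * z‖ ≤ M) :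
    ‖α‖ ≤ 1 ∧ ∀ z ∈ Kᶜ, ‖G z‖ ≤ ‖z‖ := by
  have hKc := hK.isClosed.isOpen_compl
  have h0K : (0 : ℂ) ∈ K := hKD (mem_closedBall_self zero_le_one)
  set q : ℂ → ℂ := fun ζ => if ζ = 0 then α else ζ * G ζ⁻¹ with hq
  have hq0 : q 0 = α := if_pos rfl
  have hqne {ζ : ℂ} (h : ζ ≠ 0) : q ζ = ζ * G ζ⁻¹ := if_neg h
  set U : Set ℂ := {ζ | ζ = 0 ∨ ζ⁻¹ ∈ Kᶜ} with hU
  have hne {ζ : ℂ} (h : ζ⁻¹ ∈ Kᶜ) : ζ ≠ 0 := by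
    rintro rfl
    exact h (by simpa using h0K)
  have hU1 : ∀ ζ ∈ U, ‖ζ‖ < 1 := by
    rintro ζ (rfl | h)
    · simp
    · by_contra! h1
      refine h (hKD ?_)
      rw [mem_closedBall_zero_iff, norm_inv]
      exact inv_le_one_of_one_le₀ h1
  have hUne : ∀ ζ, ζ ≠ 0 → ζ ∈ U → U ∈ 𝓝 ζ := by
    intro ζ h0 h
    have h1 : ∀ᶠ w in 𝓝 ζ, w⁻¹ ∈ Kᶜ :=
      (continuousAt_inv₀ h0).eventually_mem (hKc.mem_nhds (h.resolve_left h0))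
    exact h1.mono fun w hw => Or.inr hw
  have hU0 : U ∈ 𝓝 (0 : ℂ) := by
    have h1 : ∀ᶠ w in 𝓝[≠] (0 : ℂ), w⁻¹ ∈ Kᶜ := by
      have h2 : ∀ᶠ w in Bornology.cobounded ℂ, w ∈ Kᶜ := hK.isBounded
      exact tendsto_inv₀_nhdsNE_zero.eventually h2
    rw [eventually_nhdsWithin_iff] at h1
    filter_upwards [h1] with w hw
    by_cases h : w = 0
    · exact Or.inl h
    · exact Or.inr (hw h)
  have hUo : IsOpen U := by
    rw [isOpen_iff_mem_nhds]
    intro ζ hζ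
    by_cases h : ζ = 0
    · rw [h]; exact hU0
    · exact hUne ζ h hζ
  have hdne : ∀ ζ ∈ U, ζ ≠ 0 → DifferentiableAt ℂ q ζ := by
    intro ζ hζ h0
    have h1 : DifferentiableAt ℂ (fun w => w * G w⁻¹) ζ := by
      have hGd : DifferentiableAt ℂ G ζ⁻¹ :=
        hG.differentiableAt (hKc.mem_nhds (hζ.resolve_left h0))
      exact differentiableAt_id.mul (hGd.comp ζ (differentiableAt_inv h0))
    refine h1.congr_of_eventuallyEq ?_
    filter_upwards [isOpen_ne.mem_nhds h0] with w hw
    exact hqne hw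
  have hqc : ContinuousAt q 0 := by
    rw [ContinuousAt, hq0, tendsto_iff_norm_sub_tendsto_zero]
    have hlim : Tendsto (fun ζ : ℂ => ‖ζ‖ * M) (𝓝 0) (𝓝 0) := by
      have : Continuous fun ζ : ℂ => ‖ζ‖ * M := by fun_prop
      simpa using this.tendsto 0
    refine squeeze_zero' (Eventually.of_forall fun _ => norm_nonneg _) ?_ hlim
    filter_upwards [hU0] with ζ hζ
    by_cases h : ζ = 0
    · simp [h, hq0]
    · have h1 := hM _ (hζ.resolve_left h)
      have h2 : q ζ - α = ζ * (G ζ⁻¹ - α * ζ⁻¹) := by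
        rw [hqne h]; field_simp
      rw [h2, norm_mul]
      gcongr
  have hqd : DifferentiableOn ℂ q U := by
    intro ζ hζ
    by_cases h : ζ = 0
    · subst h
      refine (analyticAt_of_differentiable_on_punctured_nhds_of_continuousAt ?_
        hqc).differentiableAt.differentiableWithinAt
      rw [eventually_nhdsWithin_iff]
      filter_upwards [hU0] with w hw h0 using hdne w hw h0
    · exact (hdne ζ hζ h).differentiableWithinAt
  have hmax := norm_le_of_eventually_frontier hUo
    (isBounded_ball.subset fun ζ hζ => mem_ball_zero_iff.2 (hU1 ζ hζ)) hqd (a := 1)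
    (fun ξ hξ b hb => by
      have hξU : ξ ∉ U := by
        rw [frontier, hUo.interior_eq] at hξ
        exact hξ.2
      have hξ0 : ξ ≠ 0 := fun h => hξU (Or.inl h)
      have hξK : ξ⁻¹ ∈ K := by
        by_contra h
        exact hξU (Or.inr h)
      have h1 := eventually_nhdsWithin_iff.1
        (eventually_norm_le_of_bijOn_exterior hK.isClosed hG hbij hM hξK hb)
      have h2 := (continuousAt_inv₀ hξ0).eventually h1
      rw [eventually_nhdsWithin_iff]
      filter_upwards [h2, isOpen_ne.mem_nhds hξ0] with w hw hw0 hwU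
      rw [hqne hw0, norm_mul]
      have h3 := hw (hwU.resolve_left hw0)
      have h4 := hU1 w hwU
      nlinarith [norm_nonneg w, norm_nonneg (G w⁻¹)])
  refine ⟨hq0 ▸ hmax 0 (Or.inl rfl), fun z hz => ?_⟩
  have hz0 : z ≠ 0 := by
    rintro rfl
    exact hz h0K
  have h1 := hmax z⁻¹ (Or.inr (by simpa using hz))
  rw [hqne (inv_ne_zero hz0), inv_inv, norm_mul, norm_inv,
    inv_mul_le_one₀ (norm_pos_iff.2 hz0)] at h1
  exact h1

/-- A continuous logarithm of a holomorphic function is holomorphic. -/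
theorem differentiableOn_of_exp_eq {U : Set ℂ} (hU : IsOpen U) {L f : ℂ → ℂ}
    (hL : ContinuousOn L U) (hf : DifferentiableOn ℂ f U) (h : ∀ z ∈ U, exp (L z) = f z) :
    DifferentiableOn ℂ L U := by
  intro z hz
  have hd : DifferentiableAt ℂ (fun w => L z + log (f w * exp (-L z))) z := by
    have h1 : DifferentiableAt ℂ f z := hf.differentiableAt (hU.mem_nhds hz)
    refine (DifferentiableAt.clog (h1.mul_const _) ?_).const_add _
    rw [← h z hz, ← exp_add, add_neg_cancel, exp_zero]
    exact one_mem_slitPlane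
  refine (hd.congr_of_eventuallyEq ?_).differentiableWithinAt
  have hc : ContinuousAt (fun w => ‖L w - L z‖) z :=
    ((hL.continuousAt (hU.mem_nhds hz)).sub continuousAt_const).norm
  have hlt : ‖L z - L z‖ < Real.pi := by simpa using Real.pi_pos
  filter_upwards [hc.eventually_lt_const hlt, hU.mem_nhds hz] with w hw hwU
  have him := abs_lt.1 ((abs_im_le_norm (L w - L z)).trans_lt hw)
  rw [← h w hwU, ← exp_add, ← sub_eq_add_neg, log_exp him.1 him.2.le]
  ring

/-- The half plane `re ζ > -1/2` corresponds to the exterior of the unit disc. -/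
theorem one_lt_norm_one_add_inv {ζ : ℂ} (h0 : ζ ≠ 0) (h : -(1 / 2) < ζ.re) :
    1 < ‖1 + ζ⁻¹‖ := by
  have h1 : 1 + ζ⁻¹ = (ζ + 1) / ζ := by field_simp
  rw [h1, norm_div, one_lt_div (norm_pos_iff.2 h0),
    ← sq_lt_sq₀ (norm_nonneg _) (norm_nonneg _), ← normSq_eq_norm_sq, ← normSq_eq_norm_sq,
    normSq_apply, normSq_apply, add_re, add_im, one_re, one_im]
  nlinarith

/-- The line `re ζ = -1/2` corresponds to the unit circle. -/
theorem norm_one_add_inv_eq_one {ζ : ℂ} (h0 : ζ ≠ 0) (h : ζ.re = -(1 / 2)) :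
    ‖1 + ζ⁻¹‖ = 1 := by
  have h1 : 1 + ζ⁻¹ = (ζ + 1) / ζ := by field_simp
  rw [h1, norm_div, div_eq_one_iff_eq (norm_ne_zero_iff.2 h0),
    ← sq_eq_sq₀ (norm_nonneg _) (norm_nonneg _), ← normSq_eq_norm_sq, ← normSq_eq_norm_sq,
    normSq_apply, normSq_apply, add_re, add_im, one_re, one_im, h]
  ring

/-- Lipschitz estimate at infinity, in the coordinate `ζ = 1 / (z - 1)`, for a holomorphic
function on the exterior of the unit disc with a `δ`-disc about `1` removed, when its real part
is between `0` and `log ‖z‖`. -/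
theorem norm_sub_le_of_re_le_log {δ : ℝ} (hδ : δ ∈ Ioc (0 : ℝ) (1 / 3)) {F : ℂ → ℂ} {c : ℝ}
    (hF : DifferentiableOn ℂ F {z | 1 < ‖z‖ ∧ δ < ‖z - 1‖})
    (hF0 : ∀ z, 1 < ‖z‖ → δ < ‖z - 1‖ → 0 ≤ (F z).re ∧ (F z).re ≤ Real.log ‖z‖)
    (hlim : Tendsto F (cocompact ℂ) (𝓝 (c : ℂ))) (hc : 0 ≤ c)
    {z : ℂ} (hz : 1 < ‖z‖) (hzδ : 2 * δ < ‖z - 1‖) :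
    ‖F z - c‖ ≤ 4596480 * c / ‖z - 1‖ := by
  obtain ⟨hδ0, hδ3⟩ := hδ
  have hδinv : 3 ≤ 1 / δ := by rw [le_div_iff₀ hδ0]; linarith
  set Z : Set ℂ := {ζ | -(1 / 2) < ζ.re ∧ ‖ζ‖ < 1 / δ} with hZ
  have hZo : IsOpen Z :=
    (isOpen_lt continuous_const continuous_re).inter (isOpen_lt continuous_norm continuous_const)
  have hsub (ζ : ℂ) : 1 + ζ⁻¹ - 1 = ζ⁻¹ := by ring
  have hZD : ∀ ζ ∈ Z, ζ ≠ 0 → 1 < ‖1 + ζ⁻¹‖ ∧ δ < ‖1 + ζ⁻¹ - 1‖ := by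
    intro ζ hζ h0
    refine ⟨one_lt_norm_one_add_inv h0 hζ.1, ?_⟩
    rw [hsub, norm_inv, lt_inv_comm₀ hδ0 (norm_pos_iff.2 h0), ← one_div]
    exact hζ.2
  set ψ : ℂ → ℂ := fun ζ => if ζ = 0 then (c : ℂ) else F (1 + ζ⁻¹) with hψ
  have hψ0 : ψ 0 = c := if_pos rfl
  have hψne {ζ : ℂ} (h : ζ ≠ 0) : ψ ζ = F (1 + ζ⁻¹) := if_neg h
  have hDo : IsOpen {z : ℂ | 1 < ‖z‖ ∧ δ < ‖z - 1‖} :=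
    (isOpen_lt continuous_const continuous_norm).inter
      (isOpen_lt continuous_const (continuous_id.sub continuous_const).norm)
  have hdne : ∀ ζ ∈ Z, ζ ≠ 0 → DifferentiableAt ℂ ψ ζ := by
    intro ζ hζ h0
    have h1 : DifferentiableAt ℂ (fun w => F (1 + w⁻¹)) ζ := by
      have h2 : DifferentiableAt ℂ F (1 + ζ⁻¹) :=
        hF.differentiableAt (hDo.mem_nhds (hZD ζ hζ h0))
      exact h2.comp ζ ((differentiableAt_inv h0).const_add 1)
    refine h1.congr_of_eventuallyEq ?_
    filter_upwards [isOpen_ne.mem_nhds h0] with w hw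
    exact hψne hw
  have hZ0 : (0 : ℂ) ∈ Z := by
    refine ⟨by norm_num, ?_⟩
    rw [norm_zero]; positivity
  have hψc : ContinuousAt ψ 0 := by
    rw [continuousAt_iff_punctured_nhds, hψ0]
    have h1 : Tendsto (fun ζ : ℂ => 1 + ζ⁻¹) (𝓝[≠] 0) (cocompact ℂ) := by
      rw [← cobounded_eq_cocompact]
      have := tendsto_inv₀_nhdsNE_zero (α := ℂ)
      exact tendsto_const_add_cobounded 1 |>.comp this
    refine (hlim.comp h1).congr' ?_
    filter_upwards [self_mem_nhdsWithin] with ζ hζ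
    exact (hψne hζ).symm
  have hψd : DifferentiableOn ℂ ψ Z := by
    intro ζ hζ
    by_cases h : ζ = 0
    · subst h
      refine (analyticAt_of_differentiable_on_punctured_nhds_of_continuousAt ?_
        hψc).differentiableAt.differentiableWithinAt
      rw [eventually_nhdsWithin_iff]
      filter_upwards [hZo.mem_nhds hZ0] with w hw h0 using hdne w hw h0
    · exact (hdne ζ hζ h).differentiableWithinAt
  have hψre : ∀ ζ ∈ Z, 0 ≤ (ψ ζ).re := by
    intro ζ hζ
    by_cases h : ζ = 0
    · rw [h, hψ0]; simpa using hc
    · rw [hψne h]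
      exact (hF0 _ (hZD ζ hζ h).1 (hZD ζ hζ h).2).1
  have hVc : ContinuousOn (fun ζ : ℂ => if -(1 / 2) < ζ.re then (ψ ζ).re else 0)
      (ball 0 (1 / δ)) := by
    intro ζ hζ
    rw [mem_ball_zero_iff] at hζ
    apply ContinuousAt.continuousWithinAt
    rcases lt_trichotomy ζ.re (-(1 / 2)) with h | h | h
    · have h1 : ContinuousAt (fun _ : ℂ => (0 : ℝ)) ζ := continuousAt_const
      refine h1.congr ?_
      filter_upwards [(isOpen_lt continuous_re continuous_const).mem_nhds h] with w hw
      exact (if_neg (not_lt.2 (le_of_lt hw))).symm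
    · have h0 : ζ ≠ 0 := by
        rintro rfl
        norm_num at h
      have h1 : ContinuousAt (fun w : ℂ => |Real.log ‖1 + w⁻¹‖|) ζ := by
        have h2 : ContinuousAt (fun w : ℂ => ‖1 + w⁻¹‖) ζ :=
          ((continuousAt_inv₀ h0).const_add 1).norm
        exact (h2.log (by rw [norm_one_add_inv_eq_one h0 h]; exact one_ne_zero)).abs
      rw [ContinuousAt, norm_one_add_inv_eq_one h0 h, Real.log_one, abs_zero] at h1
      rw [ContinuousAt, if_neg h.not_gt]
      refine squeeze_zero' ?_ ?_ h1
      · filter_upwards [(isOpen_lt continuous_norm continuous_const).mem_nhds hζ] with w hw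
        split_ifs with hre
        · exact hψre w ⟨hre, hw⟩
        · exact le_rfl
      · filter_upwards [(isOpen_lt continuous_norm continuous_const).mem_nhds hζ,
          isOpen_ne.mem_nhds h0] with w hw hw0
        split_ifs with hre
        · rw [hψne hw0]
          have := hZD w ⟨hre, hw⟩ hw0
          exact (hF0 _ this.1 this.2).2.trans (le_abs_self _)
        · exact abs_nonneg _
    · have h1 : ContinuousAt (fun w => (ψ w).re) ζ :=
        continuous_re.continuousAt.comp (hψd.continuousOn.continuousAt (hZo.mem_nhds ⟨h, hζ⟩))
      refine h1.congr ?_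
      filter_upwards [(isOpen_lt continuous_const continuous_re).mem_nhds h] with w hw
      exact (if_pos hw).symm
  -- rescale the half disc of radius `1 / δ - 1 / 2` to radius `10 / 9`
  set l : ℝ := 9 / 10 * (1 / δ - 1 / 2) with hl
  have hl0 : 9 / 4 ≤ l := by rw [hl]; linarith
  have hlpos : 0 < l := by linarith
  have hre (s : ℂ) : ((l : ℂ) * s - 1 / 2).re = l * s.re - 1 / 2 := by simp
  have hball : ∀ s : ℂ, ‖s‖ < 10 / 9 → ‖(l : ℂ) * s - 1 / 2‖ < 1 / δ := by
    intro s hs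
    have h1 := norm_sub_le ((l : ℂ) * s) (1 / 2)
    have h2 : ‖(1 / 2 : ℂ)‖ = 1 / 2 := by norm_num
    rw [norm_mul, norm_real, Real.norm_of_nonneg hlpos.le, h2] at h1
    have h3 := mul_lt_mul_of_pos_left hs hlpos
    rw [hl] at h1 h3
    linarith
  have hmap : ∀ s : ℂ, 0 < s.re → ‖s‖ < 10 / 9 → (l : ℂ) * s - 1 / 2 ∈ Z := by
    intro s h0 hs
    refine ⟨?_, hball s hs⟩
    rw [hre]
    linarith [mul_pos hlpos h0]
  have hcont : ContinuousOn (fun s : ℂ => if 0 < s.re then (ψ ((l : ℂ) * s - 1 / 2)).re else 0)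
      (ball 0 (10 / 9)) := by
    have h1 : ContinuousOn (fun s : ℂ => (l : ℂ) * s - 1 / 2) (ball 0 (10 / 9)) := by fun_prop
    have h2 := hVc.comp h1 (fun s hs =>
      mem_ball_zero_iff.2 (hball s (mem_ball_zero_iff.1 hs)))
    refine h2.congr fun s _ => ?_
    have h3 : -(1 / 2) < ((l : ℂ) * s - 1 / 2).re ↔ 0 < s.re := by
      rw [hre, ← mul_pos_iff_of_pos_left hlpos (b := s.re)]
      constructor <;> intro h <;> linarith
    simp only [Function.comp_apply, h3]
  set ζ : ℂ := (z - 1)⁻¹ with hζ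
  have hz1 : 0 < ‖z - 1‖ := by linarith
  have hζ0 : ζ ≠ 0 := inv_ne_zero (norm_pos_iff.1 hz1)
  have hζz : 1 + ζ⁻¹ = z := by rw [hζ, inv_inv]; ring
  have hζn : ‖ζ‖ ≤ 1 / (2 * δ) := by
    rw [hζ, norm_inv, ← one_div]
    exact one_div_le_one_div_of_le (by positivity) hzδ.le
  have hζre : -(1 / 2) < ζ.re := by
    have h1 : ζ + 1 = z * ζ := by
      rw [← hζz]; field_simp
    have h2 : ‖ζ‖ < ‖ζ + 1‖ := by
      rw [h1, norm_mul]
      exact lt_mul_of_one_lt_left (norm_pos_iff.2 hζ0) hz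
    rw [← sq_lt_sq₀ (norm_nonneg _) (norm_nonneg _), ← normSq_eq_norm_sq, ← normSq_eq_norm_sq,
      normSq_apply, normSq_apply, add_re, add_im, one_re, one_im] at h2
    nlinarith
  set s : ℂ := (ζ + 1 / 2) / l with hs
  set s₀ : ℝ := 1 / 2 / l with hs₀
  have hlC : (l : ℂ) ≠ 0 := ofReal_ne_zero.2 hlpos.ne'
  have hsζ : (l : ℂ) * s - 1 / 2 = ζ := by
    rw [hs, mul_div_cancel₀ _ hlC]; ring
  have hs₀ζ : (l : ℂ) * s₀ - 1 / 2 = 0 := by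
    rw [hs₀]; push_cast; rw [mul_div_cancel₀ _ hlC]; ring
  have hsn : ‖s‖ ≤ 8 / 9 := by
    rw [hs, norm_div, norm_real, Real.norm_of_nonneg hlpos.le, div_le_iff₀ hlpos]
    have h1 := norm_add_le ζ (1 / 2)
    have h2 : ‖(1 / 2 : ℂ)‖ = 1 / 2 := by norm_num
    have h3 : 1 / (2 * δ) = 1 / 2 * (1 / δ) := by field_simp
    rw [h2] at h1
    rw [h3] at hζn
    rw [hl]
    linarith
  have hsre : 0 < s.re := by
    have h1 := hre s
    rw [hsζ] at h1
    have h2 : 0 < l * s.re := by linarith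
    exact (mul_pos_iff_of_pos_left hlpos).1 h2
  have hfin := norm_sub_le_of_vanishing_on_diameter (R := 10 / 9) (by norm_num)
    (φ := fun s => ψ ((l : ℂ) * s - 1 / 2))
    (hψd.comp (by fun_prop) fun s hs => hmap s hs.1 hs.2)
    (fun s h0 hs => hψre _ (hmap s h0 hs)) hcont (s₀ := s₀) (by positivity)
    (by rw [hs₀, div_le_iff₀ hlpos]; linarith) hsn hsre
  have hdiff : ‖s - s₀‖ = ‖ζ‖ / l := by
    have h1 : s - s₀ = ζ / l := by
      rw [hs, hs₀]; push_cast; ring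
    rw [h1, norm_div, norm_real, Real.norm_of_nonneg hlpos.le]
  simp only [hsζ, hs₀ζ, hψ0, hψne hζ0, hζz, hdiff, ofReal_re] at hfin
  refine hfin.trans (le_of_eq ?_)
  rw [hs₀, hζ, norm_inv]
  field_simp
  ring

end

/-- Proposition 4.1 (GZE): there is an absolute constant `C` such that for any cluster
`K` (compact, connected, containing the closed unit disc, with `K∖K₀` in the δ-disc
about 1), the normalized conformal map `G : D → D₀` with capacity `c` satisfies
`|log(G(z)/z) + c| ≤ C c/|z-1|` for `z ∈ D` with `|z-1| > 2δ`, where `L` is the branch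
of `log(G(z)/z)` continuous on `D` with limit `-c` at infinity. -/
theorem stmt4 : ∃ C : ℝ, 0 < C ∧ ∀ (δ : ℝ), δ ∈ Set.Ioc (0:ℝ) (1/3) →
    ∀ (K : Set ℂ) (c : ℝ) (G L : ℂ → ℂ),
    IsCompact K → IsConnected K → Metric.closedBall (0:ℂ) 1 ⊆ K →
    K \ Metric.closedBall (0:ℂ) 1 ⊆ {z : ℂ | ‖z - 1‖ ≤ δ} →
    -- G is the normalized conformal map from `D = Kᶜ` onto the exterior of the unit disc
    DifferentiableOn ℂ G Kᶜ →
    Set.BijOn G Kᶜ {z : ℂ | 1 < ‖z‖} →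
    (∃ M : ℝ, ∀ z ∈ Kᶜ, ‖G z - Real.exp (-c) * z‖ ≤ M) →
    -- L is the continuous branch of `log(G z / z)` with limit `-c` at infinity
    ContinuousOn L Kᶜ →
    (∀ z ∈ Kᶜ, Complex.exp (L z) = G z / z) →
    Filter.Tendsto L (Filter.cocompact ℂ) (nhds (-(c:ℂ))) →
    ∀ z ∈ Kᶜ, 2 * δ < ‖z - 1‖ → ‖L z + (c:ℂ)‖ ≤ C * c / ‖z - 1‖ := by
  obtain ⟨C, hC⟩ : ∃ C : ℝ, C = 4596480 := ⟨_, rfl⟩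
  refine ⟨C, by rw [hC]; norm_num, ?_⟩
  intro δ hδ K c G L hK _ hKD hKδ hG hbij hM hL hexp hlim z hz hzδ
  obtain ⟨M, hM⟩ := hM
  have hnorm := norm_le_of_bijOn_exterior hK hKD hG hbij hM
  have hout : ∀ w ∈ Kᶜ, 1 < ‖w‖ := fun w hw => by
    by_contra! h
    exact hw (hKD (mem_closedBall_zero_iff.2 h))
  have hc : 0 ≤ c := by
    have h := hnorm.1
    rw [Complex.norm_real, Real.norm_of_nonneg (Real.exp_pos _).le, Real.exp_le_one_iff] at h
    linarith
  have hDK : ∀ w : ℂ, 1 < ‖w‖ → δ < ‖w - 1‖ → w ∈ Kᶜ := by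
    intro w h1 h2 hwK
    exact absurd (hKδ ⟨hwK, fun h => not_le.2 h1 (mem_closedBall_zero_iff.1 h)⟩) (not_le.2 h2)
  have hne : ∀ w ∈ Kᶜ, w ≠ 0 := fun w hw => norm_pos_iff.1 (one_pos.trans (hout w hw))
  have hLd : DifferentiableOn ℂ L Kᶜ :=
    differentiableOn_of_exp_eq hK.isClosed.isOpen_compl hL
      (hG.div differentiableOn_id hne) hexp
  have hre : ∀ w ∈ Kᶜ, (L w).re = Real.log ‖G w‖ - Real.log ‖w‖ := by
    intro w hw
    have h1 := congrArg norm (hexp w hw)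
    have h2 : 1 < ‖G w‖ := hbij.mapsTo hw
    rw [Complex.norm_exp, norm_div] at h1
    rw [← Real.log_div (one_pos.trans h2).ne' (one_pos.trans (hout w hw)).ne', ← h1,
      Real.log_exp]
  have hest := norm_sub_le_of_re_le_log hδ (F := fun w => -L w) (c := c)
    (hLd.neg.mono fun w hw => hDK w hw.1 hw.2)
    (fun w h1 h2 => by
      have hw := hDK w h1 h2
      have h3 : 1 < ‖G w‖ := hbij.mapsTo hw
      have h4 := Real.log_nonneg h3.le
      have h5 := Real.log_le_log (one_pos.trans h3) (hnorm.2 w hw)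
      rw [Complex.neg_re, hre w hw]
      constructor <;> linarith)
    (by simpa using hlim.neg) hc (hout z hz) hzδ
  rw [hC]
  refine le_trans (le_of_eq ?_) hest
  rw [← norm_neg]
  congr 1
  ring
end
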